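/- arXiv:1709.02880 — 2 statements merged into one kernel-verified Lean document; each statement's English description precedes it below -/
import Mathlib

section
/- Let A,B ∈ ℝ^{2×2} with tr(A) = tr(B) = 0 and A − B = a ⊗ n for some a ∈ ℝ² ∖ {0}, n ∈ S¹, and let M = λA + (1−λ)B for some λ ∈ (0,1). Then there is a universal constant C > 0 such that for every δ ∈ (0,1/2) there exist a diamond Ω_δ = x₀ + rQ(conv{±e₁, ±δe₂}) ⊂ ℝ² (with x₀ ∈ ℝ², r > 0, Q ∈ SO(2)) and a piecewise affine map u : Ω_δ → ℝ² such that: (i) u(x) = Mx on ∂Ω_δ; (ii) div u = 0 a.e. in Ω_δ (equivalently tr(∇u) = 0 a.e.); (iii) dist(∇u, {A,B}) ≤ C·λ(1−λ)·δ·|a| a.e., and there are constants v_A, v_B ∈ (1/2,2) with |{x ∈ Ω_δ : dist(∇u(x),A) < dist(∇u(x),B)}| = v_A·λ·|Ω_δ| and |{x ∈ Ω_δ : dist(∇u(x),B) ≤ dist(∇u(x),A)}| = v_B·(1−λ)·|Ω_δ|; (iv) ∇u attains at most five different values; (v) Ω_δ can be divided into 10 triangles on each of which u is affine; (vi) ‖u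 − Mx‖_{L^∞(Ω_δ)} ≤ C·δ·λ(1−λ)·|a|. -/
noncomputable section
open MeasureTheory Set ENNReal Matrix

abbrev Euc (n : ℕ) := EuclideanSpace ℝ (Fin n)
abbrev Mat (n : ℕ) := Matrix (Fin n) (Fin n) ℝ

/-- The Frobenius norm of a matrix. -/
def frobNorm {n : ℕ} (A : Mat n) : ℝ := Real.sqrt (∑ i, ∑ j, (A i j) ^ 2)

/-- The continuous linear map on Euclidean space induced by a matrix. -/
def matCLM {n : ℕ} (A : Mat n) : Euc n →L[ℝ] Euc n :=
  LinearMap.toContinuousLinearMap (Matrix.toEuclideanLin A)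

/-- A matrix applied to a vector in Euclidean space. -/
def matVec {n : ℕ} (A : Mat n) (x : Euc n) : Euc n := matCLM A x

/-- The vertices `±e₁, ±δe₂ (, ±e₃)` of the model diamond. -/
def diamondVertices (n : ℕ) (δ : ℝ) : Set (Euc n) :=
  {v | ∃ i : Fin n, v = (if (i : ℕ) = 1 then δ else 1) • EuclideanSpace.single i (1 : ℝ) ∨
       v = -((if (i : ℕ) = 1 then δ else 1) • EuclideanSpace.single i (1 : ℝ))}

/-- The model diamond `conv{±e₁, ±δe₂ (, ±e₃)}`. -/
def baseDiamond (n : ℕ) (δ : ℝ) : Set (Euc n) := convexHull ℝ (diamondVertices n δ)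

/-- A diamond of aspect ratio `1:δ` (resp. `1:δ:1`). -/
def IsDiamond (n : ℕ) (δ : ℝ) (Ω : Set (Euc n)) : Prop :=
  ∃ (x₀ : Euc n) (r : ℝ) (Q : Mat n), 0 < r ∧ Qᵀ * Q = 1 ∧ Q.det = 1 ∧
    Ω = (fun y => x₀ + r • matVec Q y) '' baseDiamond n δ

/-- A continuous map which is affine on each polytope of a finite cover of `Ω`. -/
def IsPiecewiseAffine {n : ℕ} (Ω : Set (Euc n)) (u : Euc n → Euc n) : Prop :=
  ContinuousOn u Ω ∧ ∃ (N : ℕ) (P : Fin N → Set (Euc n)),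
    (∀ i, ∃ S : Finset (Euc n), P i = convexHull ℝ (S : Set (Euc n))) ∧
    Ω ⊆ ⋃ i, P i ∧
    (∀ i, ∃ (f : Euc n →ₗ[ℝ] Euc n) (b : Euc n), ∀ x ∈ P i ∩ Ω, u x = f x + b)

/-- `B` is, up to Lebesgue null sets, partitioned by the family `P`. -/
def AEPartition {n : ℕ} {ι : Type*} (B : Set (Euc n)) (P : ι → Set (Euc n)) : Prop :=
  volume (B \ ⋃ i, P i) = 0 ∧ volume ((⋃ i, P i) \ B) = 0 ∧
  ∀ i j, i ≠ j → volume (P i ∩ P j) = 0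

/-! ### Triangles in the plane -/

lemma matVec_apply_zero (A : Mat 2) (x : Euc 2) :
    matVec A x 0 = A 0 0 * x 0 + A 0 1 * x 1 := by
  simp [matVec, matCLM]

lemma matVec_apply_one (A : Mat 2) (x : Euc 2) :
    matVec A x 1 = A 1 0 * x 0 + A 1 1 * x 1 := by
  simp [matVec, matCLM]

lemma euc_ext {x y : Euc 2} (h0 : x 0 = y 0) (h1 : x 1 = y 1) : x = y := by
  ext i; fin_cases i <;> assumption

lemma mem_triangle_iff {p q r x : Euc 2} :
    x ∈ convexHull ℝ {p, q, r} ↔ ∃ α β γ : ℝ, 0 ≤ α ∧ 0 ≤ β ∧ 0 ≤ γ ∧ α + β + γ = 1 ∧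
      x 0 = α * p 0 + β * q 0 + γ * r 0 ∧ x 1 = α * p 1 + β * q 1 + γ * r 1 := by
  rw [convexHull_insert (by simp), convexHull_pair, mem_convexJoin]
  constructor
  · rintro ⟨_, rfl, y, ⟨s, t, hs, ht, hst, rfl⟩, s', t', hs', ht', hst', rfl⟩
    refine ⟨s', t' * s, t' * t, hs', by positivity, by positivity, ?_, ?_, ?_⟩
    · linear_combination hst' + t' * hst
    · simp; ring
    · simp; ring
  · rintro ⟨α, β, γ, hα, hβ, hγ, hs, h0, h1⟩
    refine ⟨p, rfl, ?_⟩
    rcases eq_or_ne (β + γ) 0 with h | h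
    · have hβ' : β = 0 := by linarith
      have hγ' : γ = 0 := by linarith
      have hα' : α = 1 := by linarith
      refine ⟨q, left_mem_segment ℝ q r, ?_⟩
      have : x = p := euc_ext (by rw [h0, hα', hβ', hγ']; ring) (by rw [h1, hα', hβ', hγ']; ring)
      rw [this]
      exact left_mem_segment ℝ p q
    · have hpos : 0 < β + γ := lt_of_le_of_ne (by positivity) h.symm
      refine ⟨(β / (β + γ)) • q + (γ / (β + γ)) • r, ⟨_, _, by positivity, by positivity,
        by field_simp, rfl⟩, α, β + γ, hα, hpos.le, by linarith, ?_⟩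
      refine euc_ext ?_ ?_
      · simp only [PiLp.add_apply, PiLp.smul_apply, smul_eq_mul, h0]; field_simp; ring
      · simp only [PiLp.add_apply, PiLp.smul_apply, smul_eq_mul, h1]; field_simp; ring

lemma volume_matVec_image (A : Mat 2) (S : Set (Euc 2)) :
    volume (matVec A '' S) = ENNReal.ofReal |A.det| * volume S := by
  have := Measure.addHaar_image_linearMap (volume : Measure (Euc 2)) (Matrix.toEuclideanLin A) S
  have hdet : LinearMap.det (Matrix.toEuclideanLin A) = A.det := by
    change LinearMap.det (Matrix.toLpLin 2 2 A) = A.det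
    rw [Matrix.toLpLin_eq_toLin, LinearMap.det_toLin]
  rw [hdet] at this
  exact this

/-- The standard simplex of the plane. -/
def stdTriangle : Set (Euc 2) := convexHull ℝ {!₂[0, 0], !₂[1, 0], !₂[0, 1]}

lemma volume_triangle (p q r : Euc 2) :
    volume (convexHull ℝ {p, q, r}) =
      ENNReal.ofReal |(q 0 - p 0) * (r 1 - p 1) - (r 0 - p 0) * (q 1 - p 1)| *
        volume stdTriangle := by
  have : convexHull ℝ {p, q, r} = (fun x => p + x) ''
      (matVec !![q 0 - p 0, r 0 - p 0; q 1 - p 1, r 1 - p 1] '' stdTriangle) := by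
    ext x
    simp only [stdTriangle, mem_image, exists_exists_and_eq_and, mem_triangle_iff]
    constructor
    · rintro ⟨α, β, γ, hα, hβ, hγ, hs, h0, h1⟩
      refine ⟨!₂[β, γ], ⟨α, β, γ, hα, hβ, hγ, hs, by simp, by simp⟩, ?_⟩
      obtain rfl : α = 1 - β - γ := by linarith
      refine euc_ext ?_ ?_
      · simp [matVec_apply_zero, h0]; ring
      · simp [matVec_apply_one, h1]; ring
    · rintro ⟨y, ⟨α, β, γ, hα, hβ, hγ, hs, h0, h1⟩, rfl⟩
      refine ⟨α, β, γ, hα, hβ, hγ, hs, ?_, ?_⟩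
      · obtain rfl : α = 1 - β - γ := by linarith
        simp [matVec_apply_zero, h0, h1]; ring
      · obtain rfl : α = 1 - β - γ := by linarith
        simp [matVec_apply_one, h0, h1]; ring
  rw [this, image_add_left, measure_preimage_add, volume_matVec_image, Matrix.det_fin_two_of]

lemma volume_affine_fiber_eq_zero {F : Type*} [AddCommGroup F] [Module ℝ F]
    (f : Euc 2 →ₗ[ℝ] F) (hf : f ≠ 0) (c : F) : volume {x | f x = c} = 0 := by
  rcases Set.eq_empty_or_nonempty {x | f x = c} with h | ⟨y, hy⟩
  · rw [h, measure_empty]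
  · have hker : f.ker ≠ ⊤ := by rwa [Ne, LinearMap.ker_eq_top]
    have : {x | f x = c} = (fun x => y + x) '' (f.ker : Set (Euc 2)) := by
      ext x
      simp only [mem_ofPred_eq, image_add_left, mem_preimage, SetLike.mem_coe, LinearMap.mem_ker,
        map_add, map_neg]
      rw [show f y = c from hy, neg_add_eq_zero, eq_comm]
    rw [this, image_add_left, measure_preimage_add, Measure.addHaar_submodule _ _ hker]

/-! ### The model diamond and its triangulation -/

lemma mem_baseDiamond_iff {d : ℝ} (hd : 0 < d) {x : Euc 2} :
    x ∈ baseDiamond 2 d ↔ d * |x 0| + |x 1| ≤ d := by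
  have hV : diamondVertices 2 d = {!₂[1, 0], !₂[-1, 0], !₂[0, d], !₂[0, -d]} := by
    ext v
    simp only [diamondVertices, mem_ofPred_eq, Fin.exists_fin_two, mem_insert_iff,
      mem_singleton_iff, or_assoc]
    have e1 : ((if ((0 : Fin 2) : ℕ) = 1 then d else 1) • EuclideanSpace.single (0 : Fin 2) (1 : ℝ))
        = !₂[1, 0] := by apply euc_ext <;> simp
    have e2 : ((if ((1 : Fin 2) : ℕ) = 1 then d else 1) • EuclideanSpace.single (1 : Fin 2) (1 : ℝ))
        = !₂[0, d] := by apply euc_ext <;> simp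
    have e3 : -(!₂[1, 0] : Euc 2) = !₂[-1, 0] := by apply euc_ext <;> simp
    have e4 : -(!₂[0, d] : Euc 2) = !₂[0, -d] := by apply euc_ext <;> simp
    rw [e1, e2, e3, e4]
  rw [baseDiamond, hV]
  constructor
  · intro hx
    have hconv : Convex ℝ {y : Euc 2 | d * |y 0| + |y 1| ≤ d} := by
      intro y hy z hz a b ha hb hab
      simp only [mem_ofPred_eq, PiLp.add_apply, PiLp.smul_apply, smul_eq_mul] at *
      have h0 : |a * y 0 + b * z 0| ≤ a * |y 0| + b * |z 0| := by
        refine (abs_add_le _ _).trans ?_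
        rw [abs_mul, abs_mul, abs_of_nonneg ha, abs_of_nonneg hb]
      have h1 : |a * y 1 + b * z 1| ≤ a * |y 1| + b * |z 1| := by
        refine (abs_add_le _ _).trans ?_
        rw [abs_mul, abs_mul, abs_of_nonneg ha, abs_of_nonneg hb]
      calc d * |a * y 0 + b * z 0| + |a * y 1 + b * z 1|
          ≤ d * (a * |y 0| + b * |z 0|) + (a * |y 1| + b * |z 1|) := by gcongr
        _ = a * (d * |y 0| + |y 1|) + b * (d * |z 0| + |z 1|) := by ring
        _ ≤ a * d + b * d := by gcongr
        _ = d := by rw [← add_mul, hab, one_mul]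
    refine convexHull_min ?_ hconv hx
    rintro y (rfl | rfl | rfl | rfl) <;> simp [abs_of_pos hd]
  · intro hx
    set H := convexHull ℝ ({!₂[1, 0], !₂[-1, 0], !₂[0, d], !₂[0, -d]} : Set (Euc 2)) with hH
    have hconv : Convex ℝ H := convex_convexHull ℝ _
    have v1 : !₂[1, 0] ∈ H := subset_convexHull ℝ _ (by simp)
    have v2 : !₂[-1, 0] ∈ H := subset_convexHull ℝ _ (by simp)
    have v3 : !₂[0, d] ∈ H := subset_convexHull ℝ _ (by simp)
    have v4 : !₂[0, -d] ∈ H := subset_convexHull ℝ _ (by simp)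
    set t := |x 1| / d with ht
    have ht' : |x 1| = t * d := by rw [ht]; field_simp
    have hxt : |x 0| + t ≤ 1 := by
      rw [ht'] at hx
      nlinarith
    have hz : (0 : Euc 2) ∈ H := by
      have := hconv v1 v2
        (by norm_num : (0 : ℝ) ≤ 1 / 2) (by norm_num : (0 : ℝ) ≤ 1 / 2) (by norm_num)
      convert this using 1
      apply euc_ext <;> simp
    have hP : ∃ P ∈ H, |x 0| * P 0 = x 0 ∧ P 1 = 0 := by
      rcases le_total 0 (x 0) with h | h
      · exact ⟨_, v1, by simp [abs_of_nonneg h], by simp⟩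
      · exact ⟨_, v2, by simp [abs_of_nonpos h], by simp⟩
    have hQ : ∃ Q ∈ H, Q 0 = 0 ∧ t * Q 1 = x 1 := by
      rcases le_total 0 (x 1) with h | h
      · exact ⟨_, v3, by simp,
          by simp; rw [← ht', abs_of_nonneg h]⟩
      · exact ⟨_, v4, by simp,
          by simp; rw [← ht', abs_of_nonpos h, neg_neg]⟩
    obtain ⟨P, hP, hP0, hP1⟩ := hP
    obtain ⟨Q, hQ, hQ0, hQ1⟩ := hQ
    have := hconv.sum_mem (t := Finset.univ) (w := ![1 - |x 0| - t, |x 0|, t]) (z := ![0, P, Q])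
      (by intro i _; fin_cases i
          · simp; linarith
          · simp
          · simp; positivity)
      (by simp [Fin.sum_univ_three]; ring)
      (by intro i _; fin_cases i <;> simp [hz, hP, hQ])
    convert this using 1
    apply euc_ext <;> simp [Fin.sum_univ_three, hP0, hP1, hQ0, hQ1]

/-- Half the height of the inner rectangle. -/
def innerHeight (l d : ℝ) : ℝ := l * d * (1 - d)

/-- Vertices of five triangles which, together with their reflections in the origin, triangulate
the model diamond. -/
def modelVertex (l d : ℝ) : Fin 5 → Fin 3 → Euc 2 :=
  ![![!₂[d, -innerHeight l d], !₂[-d, innerHeight l d], !₂[d, innerHeight l d]],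
    ![!₂[1, 0], !₂[d, innerHeight l d], !₂[d, -innerHeight l d]],
    ![!₂[0, d], !₂[d, innerHeight l d], !₂[-d, innerHeight l d]],
    ![!₂[1, 0], !₂[0, d], !₂[d, innerHeight l d]],
    ![!₂[1, 0], !₂[0, -d], !₂[d, -innerHeight l d]]]

/-- The five model triangles. -/
def modelTriangle (l d : ℝ) (j : Fin 5) : Set (Euc 2) :=
  convexHull ℝ {modelVertex l d j 0, modelVertex l d j 1, modelVertex l d j 2}

section Model

variable {l d : ℝ}

lemma mem_modelTriangle_zero (hl : l ∈ Ioo (0 : ℝ) 1) (hd : d ∈ Ioo (0 : ℝ) 1) {x : Euc 2} :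
    x ∈ modelTriangle l d 0 ↔
      x 0 ≤ d ∧ x 1 ≤ innerHeight l d ∧ 0 ≤ innerHeight l d * x 0 + d * x 1 := by
  obtain ⟨hl0, hl1⟩ := hl
  obtain ⟨hd0, hd1⟩ := hd
  have hh : 0 < innerHeight l d := by
    have := sub_pos.2 hd1
    unfold innerHeight; positivity
  simp only [modelTriangle, modelVertex, mem_triangle_iff]
  set h := innerHeight l d
  simp only [Matrix.cons_val, PiLp.toLp_apply]
  constructor
  · rintro ⟨α, β, γ, hα, hβ, hγ, hs, h0, h1⟩
    obtain rfl : α = 1 - β - γ := by linarith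
    refine ⟨?_, ?_, ?_⟩
    · rw [h0]; nlinarith
    · rw [h1]; nlinarith
    · rw [h0, h1]; nlinarith [mul_nonneg (mul_nonneg hγ hd0.le) hh.le]
  · rintro ⟨h1, h2, h3⟩
    refine ⟨(1 - x 1 / h) / 2, (1 - x 0 / d) / 2, (x 0 / d + x 1 / h) / 2, ?_, ?_, ?_,
      by ring, ?_, ?_⟩
    · have : x 1 / h ≤ 1 := (div_le_one hh).2 h2
      linarith
    · have : x 0 / d ≤ 1 := (div_le_one hd0).2 h1
      linarith
    · rw [show (x 0 / d + x 1 / h) / 2 = (h * x 0 + d * x 1) / (2 * d * h) by field_simp]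
      positivity
    · field_simp; ring
    · field_simp; ring

lemma mem_modelTriangle_one (hl : l ∈ Ioo (0 : ℝ) 1) (hd : d ∈ Ioo (0 : ℝ) 1) {x : Euc 2} :
    x ∈ modelTriangle l d 1 ↔ d ≤ x 0 ∧ |x 1| ≤ l * d * (1 - x 0) := by
  obtain ⟨hl0, hl1⟩ := hl
  obtain ⟨hd0, hd1⟩ := hd
  have hd2 := sub_pos.2 hd1
  simp only [modelTriangle, modelVertex, mem_triangle_iff, innerHeight, Matrix.cons_val, abs_le]
  constructor
  · rintro ⟨α, β, γ, hα, hβ, hγ, hs, h0, h1⟩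
    obtain rfl : α = 1 - β - γ := by linarith
    have hp : 0 ≤ l * d * (1 - d) := by positivity
    refine ⟨?_, ?_, ?_⟩
    · rw [h0]; nlinarith
    · rw [h0, h1]; nlinarith [mul_nonneg hβ hp]
    · rw [h0, h1]; nlinarith [mul_nonneg hγ hp]
  · rintro ⟨h1, h2, h3⟩
    refine ⟨(x 0 - d) / (1 - d), (l * d * (1 - x 0) + x 1) / (2 * (l * d * (1 - d))),
      (l * d * (1 - x 0) - x 1) / (2 * (l * d * (1 - d))), ?_, ?_, ?_, ?_, ?_, ?_⟩
    · exact div_nonneg (by linarith) hd2.le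
    · exact div_nonneg (by linarith) (by positivity)
    · exact div_nonneg (by linarith) (by positivity)
    · field_simp; ring
    · field_simp; ring
    · field_simp; ring

lemma mem_modelTriangle_two (hl : l ∈ Ioo (0 : ℝ) 1) (hd : d ∈ Ioo (0 : ℝ) 1) {x : Euc 2} :
    x ∈ modelTriangle l d 2 ↔
      innerHeight l d ≤ x 1 ∧ |x 0| * (1 - l * (1 - d)) ≤ d - x 1 := by
  obtain ⟨hl0, hl1⟩ := hl
  obtain ⟨hd0, hd1⟩ := hd
  have hw : 0 < 1 - l * (1 - d) := by nlinarith
  simp only [modelTriangle, modelVertex, mem_triangle_iff, Matrix.cons_val]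
  set w := 1 - l * (1 - d) with hwdef
  have hh : innerHeight l d = d * (1 - w) := by simp only [innerHeight, hwdef]; ring
  rw [hh, ← abs_of_pos hw, ← abs_mul, abs_le, abs_of_pos hw]
  constructor
  · rintro ⟨α, β, γ, hα, hβ, hγ, hs, h0, h1⟩
    obtain rfl : α = 1 - β - γ := by linarith
    have hp : 0 ≤ d * w := by positivity
    refine ⟨?_, ?_, ?_⟩
    · rw [h1]; nlinarith
    · rw [h0, h1]; nlinarith [mul_nonneg hβ hp]
    · rw [h0, h1]; nlinarith [mul_nonneg hγ hp]
  · rintro ⟨h1, h2, h3⟩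
    refine ⟨(x 1 - d * (1 - w)) / (d * w), (d - x 1 + x 0 * w) / (2 * (d * w)),
      (d - x 1 - x 0 * w) / (2 * (d * w)), ?_, ?_, ?_, ?_, ?_, ?_⟩
    · exact div_nonneg (by linarith) (by positivity)
    · exact div_nonneg (by linarith) (by positivity)
    · exact div_nonneg (by linarith) (by positivity)
    · field_simp; ring
    · field_simp; ring
    · field_simp; ring

lemma mem_modelTriangle_three (hl : l ∈ Ioo (0 : ℝ) 1) (hd : d ∈ Ioo (0 : ℝ) 1) {x : Euc 2} :
    x ∈ modelTriangle l d 3 ↔ x 1 ≤ d * (1 - x 0) ∧ d - x 1 ≤ x 0 * (1 - l * (1 - d)) ∧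
      l * d * (1 - x 0) ≤ x 1 := by
  obtain ⟨hl0, hl1⟩ := hl
  obtain ⟨hd0, hd1⟩ := hd
  have hd2 := sub_pos.2 hd1
  have hl2 := sub_pos.2 hl1
  simp only [modelTriangle, modelVertex, mem_triangle_iff, innerHeight, Matrix.cons_val]
  constructor
  · rintro ⟨α, β, γ, hα, hβ, hγ, hs, h0, h1⟩
    obtain rfl : γ = 1 - α - β := by linarith
    refine ⟨?_, ?_, ?_⟩
    · rw [h0, h1]; nlinarith [mul_nonneg hγ (mul_nonneg (mul_nonneg hd0.le hd2.le) hl2.le)]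
    · rw [h0, h1]; nlinarith [mul_nonneg hα (mul_nonneg hl2.le hd2.le)]
    · rw [h0, h1]; nlinarith [mul_nonneg hβ (mul_nonneg hl2.le hd0.le)]
  · rintro ⟨h1, h2, h3⟩
    refine ⟨(x 0 * (1 - l * (1 - d)) - (d - x 1)) / ((1 - l) * (1 - d)),
      (x 1 - l * d * (1 - x 0)) / ((1 - l) * d),
      (d * (1 - x 0) - x 1) / (d * (1 - d) * (1 - l)), ?_, ?_, ?_, ?_, ?_, ?_⟩
    · exact div_nonneg (by linarith) (by positivity)
    · exact div_nonneg (by linarith) (by positivity)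
    · exact div_nonneg (by linarith) (by positivity)
    · field_simp; ring
    · field_simp; ring
    · field_simp; ring

lemma mem_modelTriangle_four (hl : l ∈ Ioo (0 : ℝ) 1) (hd : d ∈ Ioo (0 : ℝ) 1) {x : Euc 2} :
    x ∈ modelTriangle l d 4 ↔ -x 1 ≤ d * (1 - x 0) ∧ d + x 1 ≤ x 0 * (1 - l * (1 - d)) ∧
      l * d * (1 - x 0) ≤ -x 1 := by
  have key : x ∈ modelTriangle l d 4 ↔ !₂[x 0, -x 1] ∈ modelTriangle l d 3 := by
    simp only [modelTriangle, modelVertex, mem_triangle_iff, Matrix.cons_val]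
    have (α β γ : ℝ) : (x 1 = α * 0 + β * -d + γ * -innerHeight l d) ↔
        (-x 1 = α * 0 + β * d + γ * innerHeight l d) := by
      constructor <;> intro h <;> linear_combination -h
    simp only [this]
  rw [key, mem_modelTriangle_three hl hd]
  simp

/-! ### The model displacement -/

/-- Truncation of `t` to the interval `[-|m|, |m|]`. -/
def clamp (m t : ℝ) : ℝ := max (-|m|) (min t |m|)

lemma clamp_neg (m t : ℝ) : clamp m (-t) = -clamp m t := by
  have := abs_nonneg m
  unfold clamp
  grind

lemma clamp_of_abs_le {m t : ℝ} (h : |t| ≤ m) : clamp m t = t := by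
  have hm := abs_of_nonneg ((abs_nonneg t).trans h)
  rw [abs_le] at h
  rw [clamp, hm, min_eq_left h.2, max_eq_right h.1]

lemma clamp_of_le {m t : ℝ} (hm : 0 ≤ m) (h : m ≤ t) : clamp m t = m := by
  rw [clamp, abs_of_nonneg hm, min_eq_right h, max_eq_right (by linarith)]

lemma abs_clamp_le (m t : ℝ) : |clamp m t| ≤ |m| := by
  have := abs_nonneg m
  rw [abs_le]
  exact ⟨le_max_left _ _, max_le (by linarith) (min_le_right _ _)⟩

/-- The modulus of the vertical slope in the top and bottom triangles. -/
def capSlope (l d : ℝ) : ℝ := l * (1 - l) * (1 - d) / (1 - l * (1 - d))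

/-- The divergence-free displacement of the model diamond, vanishing on its boundary. -/
def modelDisp (l d : ℝ) (x : Euc 2) : Euc 2 :=
  !₂[clamp (min (capSlope l d * (d - |x 1|)) (l * (d * (1 - |x 0|) - |x 1|))) ((1 - l) * x 1),
    -clamp (min (l * (1 - l) * d ^ 2 * (1 - |x 0|)) (l * d * (d * (1 - |x 0|) - |x 1|)))
      (l * (1 - l) * d * (1 - d) * x 0)]

/-- The five gradients of the model displacement. -/
def modelGrad (l d : ℝ) : Fin 5 → Mat 2 :=
  ![!![0, 1 - l; -(l * (1 - l) * d * (1 - d)), 0],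
    !![0, 1 - l; l * (1 - l) * d ^ 2, 0],
    !![0, -capSlope l d; -(l * (1 - l) * d * (1 - d)), 0],
    !![-(l * d), -l; l * d ^ 2, l * d],
    !![l * d, -l; l * d ^ 2, -(l * d)]]

/-- The translation parts of the model displacement on the five model triangles. -/
def modelShift (l d : ℝ) : Fin 5 → Euc 2 :=
  ![!₂[0, 0], !₂[0, -(l * (1 - l) * d ^ 2)], !₂[capSlope l d * d, 0],
    !₂[l * d, -(l * d ^ 2)], !₂[-(l * d), -(l * d ^ 2)]]

lemma continuous_modelDisp (l d : ℝ) : Continuous (modelDisp l d) := by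
  unfold modelDisp clamp
  fun_prop

lemma modelDisp_neg (l d : ℝ) (x : Euc 2) : modelDisp l d (-x) = -modelDisp l d x := by
  apply euc_ext <;> simp [modelDisp, clamp_neg]

lemma capSlope_mul (hl : l ∈ Ioo (0 : ℝ) 1) (hd : d ∈ Ioo (0 : ℝ) 1) :
    capSlope l d * (1 - l * (1 - d)) = l * (1 - l) * (1 - d) := by
  have : 0 < 1 - l * (1 - d) := by nlinarith [hl.1, hl.2, hd.1, hd.2]
  exact div_mul_cancel₀ _ this.ne'

lemma capSlope_pos (hl : l ∈ Ioo (0 : ℝ) 1) (hd : d ∈ Ioo (0 : ℝ) 1) : 0 < capSlope l d := by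
  have : 0 < 1 - l * (1 - d) := by nlinarith [hl.1, hl.2, hd.1, hd.2]
  have := hl.1
  have := sub_pos.2 hl.2
  have := sub_pos.2 hd.2
  unfold capSlope; positivity

lemma edge_bounds (hl : l ∈ Ioo (0 : ℝ) 1) (hd : d ∈ Ioo (0 : ℝ) 1) {X Y : ℝ}
    (h1 : Y ≤ d * (1 - X)) (h2 : d - Y ≤ X * (1 - l * (1 - d))) (h3 : l * d * (1 - X) ≤ Y) :
    0 ≤ X ∧ 0 ≤ Y ∧ 0 ≤ l * (d * (1 - X) - Y) ∧
      l * (d * (1 - X) - Y) ≤ capSlope l d * (d - Y) ∧ l * (d * (1 - X) - Y) ≤ (1 - l) * Y ∧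
      l * d * (d * (1 - X) - Y) ≤ l * (1 - l) * d ^ 2 * (1 - X) ∧
      l * d * (d * (1 - X) - Y) ≤ l * (1 - l) * d * (1 - d) * X := by
  have hl0 := hl.1
  have hd0 := hd.1
  have hl2 := sub_pos.2 hl.2
  have hd2 := sub_pos.2 hd.2
  have hw : 0 < 1 - l * (1 - d) := by nlinarith
  have hX : 0 ≤ X := by
    have : 0 ≤ (1 - l) * (1 - d) * X := by nlinarith
    exact nonneg_of_mul_nonneg_right this (by positivity)
  have hX1 : 0 ≤ 1 - X := by
    have : 0 ≤ (1 - l) * d * (1 - X) := by nlinarith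
    exact nonneg_of_mul_nonneg_right this (by positivity)
  have hlk : l - capSlope l d = l * d / (1 - l * (1 - d)) := by
    rw [capSlope]; field_simp; ring
  refine ⟨hX, le_trans (by positivity) h3, mul_nonneg hl0.le (by linarith), ?_, by linarith, ?_, ?_⟩
  · have : (l - capSlope l d) * (d - Y) ≤ l * d * X := by
      rw [hlk, div_mul_eq_mul_div, div_le_iff₀ hw]
      nlinarith [mul_nonneg (mul_nonneg hl0.le hd0.le) (sub_nonneg.2 h2)]
    linarith
  · nlinarith [mul_nonneg (mul_nonneg hl0.le hd0.le) (sub_nonneg.2 h3)]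
  · nlinarith [mul_nonneg (mul_nonneg hl0.le hd0.le) (sub_nonneg.2 h2)]

/-- The model displacement is affine on each model triangle. -/
lemma modelDisp_eq (hl : l ∈ Ioo (0 : ℝ) 1) (hd : d ∈ Ioo (0 : ℝ) 1) {j : Fin 5} {x : Euc 2}
    (hx : x ∈ modelTriangle l d j) :
    modelDisp l d x = matVec (modelGrad l d j) x + modelShift l d j := by
  have hκ := capSlope_mul hl hd
  have hκ0 := capSlope_pos hl hd
  have hl0 := hl.1
  have hd0 := hd.1
  have hl2 := sub_pos.2 hl.2
  have hd2 := sub_pos.2 hd.2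
  have hw : 0 < 1 - l * (1 - d) := by nlinarith
  have hll : 0 < l * (1 - l) := by positivity
  fin_cases j
  · rw [Fin.zero_eta, mem_modelTriangle_zero hl hd, innerHeight] at hx
    obtain ⟨h1, h2, h3⟩ := hx
    have hX : |x 0| ≤ d := by
      refine abs_le.2 ⟨?_, h1⟩
      have : 0 ≤ d * (l * (1 - d)) * (x 0 + d) := by nlinarith
      have := nonneg_of_mul_nonneg_right this (by positivity)
      linarith
    have hY : |x 1| ≤ l * d * (1 - d) := by
      refine abs_le.2 ⟨?_, h2⟩
      have : 0 ≤ d * (x 1 + l * d * (1 - d)) := by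
        nlinarith [mul_nonneg (mul_nonneg (mul_nonneg hl0.le hd0.le) hd2.le) (sub_nonneg.2 h1)]
      have := nonneg_of_mul_nonneg_right this hd0
      linarith
    have hYX : |x 1| ≤ l * d * (1 - |x 0|) := by
      nlinarith [mul_nonneg (mul_nonneg hl0.le hd0.le) (sub_nonneg.2 hX)]
    have c1 : |(1 - l) * x 1| ≤
        min (capSlope l d * (d - |x 1|)) (l * (d * (1 - |x 0|) - |x 1|)) := by
      rw [abs_mul, abs_of_pos hl2, le_min_iff]
      constructor
      · have e : capSlope l d * (d * (1 - l * (1 - d))) = (1 - l) * (l * d * (1 - d)) := by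
          linear_combination d * hκ
        nlinarith [mul_nonneg hκ0.le (sub_nonneg.2 hY), mul_nonneg hl2.le (sub_nonneg.2 hY)]
      · nlinarith
    have c2 : |l * (1 - l) * d * (1 - d) * x 0| ≤
        min (l * (1 - l) * d ^ 2 * (1 - |x 0|)) (l * d * (d * (1 - |x 0|) - |x 1|)) := by
      rw [abs_mul, abs_of_nonneg (by positivity), le_min_iff]
      constructor
      · nlinarith [mul_nonneg (mul_nonneg hll.le hd0.le) (sub_nonneg.2 hX)]
      · nlinarith [mul_nonneg (mul_nonneg hl0.le hd0.le) (sub_nonneg.2 hYX),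
          mul_nonneg (mul_nonneg hll.le hd0.le) (sub_nonneg.2 hX)]
    simp only [modelDisp, clamp_of_abs_le c1, clamp_of_abs_le c2]
    apply euc_ext <;> simp [matVec_apply_zero, matVec_apply_one, modelGrad, modelShift]
  · rw [Fin.mk_one, mem_modelTriangle_one hl hd] at hx
    obtain ⟨h1, h2⟩ := hx
    have hX : |x 0| = x 0 := abs_of_nonneg (by linarith)
    have hx1 : 0 ≤ 1 - x 0 :=
      nonneg_of_mul_nonneg_right ((abs_nonneg (x 1)).trans h2) (by positivity)
    have c1 : |(1 - l) * x 1| ≤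
        min (capSlope l d * (d - |x 1|)) (l * (d * (1 - |x 0|) - |x 1|)) := by
      rw [abs_mul, abs_of_pos hl2, le_min_iff, hX]
      have hY : |x 1| ≤ l * d * (1 - d) := by
        nlinarith [mul_nonneg (mul_nonneg hl0.le hd0.le) (sub_nonneg.2 h1)]
      constructor
      · have e : capSlope l d * (d * (1 - l * (1 - d))) = (1 - l) * (l * d * (1 - d)) := by
          linear_combination d * hκ
        nlinarith [mul_nonneg hκ0.le (sub_nonneg.2 hY), mul_nonneg hl2.le (sub_nonneg.2 hY)]
      · nlinarith
    have c2 : min (l * (1 - l) * d ^ 2 * (1 - |x 0|)) (l * d * (d * (1 - |x 0|) - |x 1|)) =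
        l * (1 - l) * d ^ 2 * (1 - x 0) := by
      rw [hX]
      refine min_eq_left ?_
      nlinarith [mul_nonneg (mul_nonneg hl0.le hd0.le) (sub_nonneg.2 h2)]
    simp only [modelDisp, clamp_of_abs_le c1, c2]
    rw [clamp_of_le (by positivity)
      (by nlinarith [mul_nonneg (mul_nonneg hll.le hd0.le) (sub_nonneg.2 h1)])]
    apply euc_ext
    · simp [matVec_apply_zero, modelGrad, modelShift]
    · simp [matVec_apply_one, modelGrad, modelShift]; ring
  · rw [show (⟨2, by simp⟩ : Fin 5) = 2 from rfl, mem_modelTriangle_two hl hd, innerHeight] at hx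
    obtain ⟨h1, h2⟩ := hx
    have hY : |x 1| = x 1 := abs_of_nonneg (le_trans (by positivity) h1)
    have hd1 : 0 ≤ d - x 1 := le_trans (by positivity) h2
    have hX : |x 0| ≤ d := by
      have : |x 0| * (1 - l * (1 - d)) ≤ d * (1 - l * (1 - d)) := by linarith
      exact le_of_mul_le_mul_right this hw
    have hκκ : capSlope l d * |x 0| * (1 - l * (1 - d)) = l * (1 - l) * (1 - d) * |x 0| := by
      linear_combination |x 0| * hκ
    have hκd : capSlope l d * (1 - l * (1 - d)) * d = l * (1 - l) * (1 - d) * d := by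
      linear_combination d * hκ
    have hlk : l - capSlope l d = l * d / (1 - l * (1 - d)) := by
      rw [capSlope]; field_simp; ring
    have hkey : capSlope l d * (d - x 1) ≤ l * (d * (1 - |x 0|) - x 1) := by
      have : l * d * |x 0| ≤ (l - capSlope l d) * (d - x 1) := by
        rw [hlk, div_mul_eq_mul_div, le_div_iff₀ hw]
        nlinarith [mul_nonneg (mul_nonneg hl0.le hd0.le) (sub_nonneg.2 h2)]
      linarith
    have c1 : min (capSlope l d * (d - |x 1|)) (l * (d * (1 - |x 0|) - |x 1|)) =
        capSlope l d * (d - x 1) := by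
      rw [hY, min_eq_left hkey]
    have c2 : |l * (1 - l) * d * (1 - d) * x 0| ≤
        min (l * (1 - l) * d ^ 2 * (1 - |x 0|)) (l * d * (d * (1 - |x 0|) - |x 1|)) := by
      rw [abs_mul, abs_of_nonneg (by positivity), le_min_iff, hY]
      constructor
      · nlinarith [mul_nonneg (mul_nonneg hll.le hd0.le) (sub_nonneg.2 hX)]
      · have : l * (1 - l) * (1 - d) * |x 0| ≤ capSlope l d * (d - x 1) := by
          rw [← hκκ, mul_assoc]
          exact mul_le_mul_of_nonneg_left h2 hκ0.le
        nlinarith [mul_le_mul_of_nonneg_left (this.trans hkey) hd0.le]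
    have c3 : capSlope l d * (d - x 1) ≤ (1 - l) * x 1 := by
      nlinarith [mul_nonneg hκ0.le (sub_nonneg.2 h1), mul_nonneg hl2.le (sub_nonneg.2 h1)]
    simp only [modelDisp, clamp_of_abs_le c2, c1]
    rw [clamp_of_le (by positivity) c3]
    apply euc_ext
    · simp [matVec_apply_zero, modelGrad, modelShift]; ring
    · simp [matVec_apply_one, modelGrad, modelShift]
  · rw [show (⟨3, by simp⟩ : Fin 5) = 3 from rfl, mem_modelTriangle_three hl hd] at hx
    obtain ⟨hX, hY, he, b1, b2, b3, b4⟩ := edge_bounds hl hd hx.1 hx.2.1 hx.2.2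
    have he2 : 0 ≤ l * d * (d * (1 - x 0) - x 1) := by nlinarith
    simp only [modelDisp, abs_of_nonneg hX, abs_of_nonneg hY, min_eq_right b1, min_eq_right b3,
      clamp_of_le he b2, clamp_of_le he2 b4]
    apply euc_ext
    · simp [matVec_apply_zero, modelGrad, modelShift]; ring
    · simp [matVec_apply_one, modelGrad, modelShift]; ring
  · rw [show (⟨4, by simp⟩ : Fin 5) = 4 from rfl, mem_modelTriangle_four hl hd] at hx
    obtain ⟨hX, hY, he, b1, b2, b3, b4⟩ :=
      edge_bounds (Y := -x 1) hl hd hx.1 (by linarith [hx.2.1]) hx.2.2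
    have he2 : 0 ≤ l * d * (d * (1 - x 0) - -x 1) := by nlinarith
    have b2' : clamp (l * (d * (1 - x 0) - -x 1)) ((1 - l) * x 1) =
        -(l * (d * (1 - x 0) - -x 1)) := by
      rw [show (1 - l) * x 1 = -((1 - l) * -x 1) by ring, clamp_neg, clamp_of_le he b2]
    simp only [modelDisp, abs_of_nonneg hX, abs_of_nonpos (neg_nonneg.1 hY), min_eq_right b1,
      min_eq_right b3, b2', clamp_of_le he2 b4]
    apply euc_ext
    · simp [matVec_apply_zero, modelGrad, modelShift]; ring
    · simp [matVec_apply_one, modelGrad, modelShift]; ring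

/-- A linear functional, nonnegative on the corresponding model triangle. -/
def modelNormal (l d : ℝ) : Fin 5 → Mat 2 :=
  ![!![innerHeight l d, d; 0, 0], !![1, 0; 0, 0], !![0, 1; 0, 0], !![1, 0; 0, 0], !![1, 0; 0, 0]]

lemma modelNormal_ne_zero (hd : d ≠ 0) (j : Fin 5) : modelNormal l d j ≠ 0 := by
  intro h
  have h0 : modelNormal l d j 0 0 = 0 := by rw [h]; rfl
  have h1 : modelNormal l d j 0 1 = 0 := by rw [h]; rfl
  fin_cases j
  · exact hd h1
  · exact one_ne_zero h0
  · exact one_ne_zero h1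
  · exact one_ne_zero h0
  · exact one_ne_zero h0

lemma modelNormal_nonneg (hl : l ∈ Ioo (0 : ℝ) 1) (hd : d ∈ Ioo (0 : ℝ) 1) {j : Fin 5} {x : Euc 2}
    (hx : x ∈ modelTriangle l d j) : 0 ≤ matVec (modelNormal l d j) x 0 := by
  have hl0 := hl.1
  have hd0 := hd.1
  have hd2 := sub_pos.2 hd.2
  rw [matVec_apply_zero]
  fin_cases j
  · exact ((mem_modelTriangle_zero hl hd).1 hx).2.2
  · have := ((mem_modelTriangle_one hl hd).1 hx).1
    simp [modelNormal]; linarith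
  · have := ((mem_modelTriangle_two hl hd).1 hx).1
    simp [modelNormal]
    refine le_trans ?_ this
    unfold innerHeight; positivity
  · have h := (mem_modelTriangle_three hl hd).1 hx
    simpa [modelNormal] using (edge_bounds hl hd h.1 h.2.1 h.2.2).1
  · have h := (mem_modelTriangle_four hl hd).1 hx
    simpa [modelNormal] using
      (edge_bounds (Y := -x 1) hl hd h.1 (by linarith [h.2.1]) h.2.2).1

lemma modelGrad_injective (hl : l ∈ Ioo (0 : ℝ) 1) (hd : d ∈ Ioo (0 : ℝ) 1) :
    Function.Injective (modelGrad l d) := by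
  have hκ0 := capSlope_pos hl hd
  have hl0 := hl.1
  have hd0 := hd.1
  have hl2 := sub_pos.2 hl.2
  have hd2 := sub_pos.2 hd.2
  have h1 : 0 < l * d := by positivity
  have h2 : 0 < l * (1 - l) * d * (1 - d) := by positivity
  have h3 : 0 < l * (1 - l) * d ^ 2 := by positivity
  intro i j hij
  have e0 : modelGrad l d i 0 0 = modelGrad l d j 0 0 := by rw [hij]
  have e1 : modelGrad l d i 0 1 = modelGrad l d j 0 1 := by rw [hij]
  have e2 : modelGrad l d i 1 0 = modelGrad l d j 1 0 := by rw [hij]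
  have E0 (k : Fin 5) : modelGrad l d k 0 0 = ![0, 0, 0, -(l * d), l * d] k := by
    fin_cases k <;> rfl
  have E1 (k : Fin 5) : modelGrad l d k 0 1 = ![1 - l, 1 - l, -capSlope l d, -l, -l] k := by
    fin_cases k <;> rfl
  have E2 (k : Fin 5) : modelGrad l d k 1 0 = ![-(l * (1 - l) * d * (1 - d)),
      l * (1 - l) * d ^ 2, -(l * (1 - l) * d * (1 - d)), l * d ^ 2, l * d ^ 2] k := by
    fin_cases k <;> rfl
  rw [E0, E0] at e0
  rw [E1, E1] at e1
  rw [E2, E2] at e2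
  clear hij E0 E1 E2
  fin_cases i <;> fin_cases j <;>
    first | rfl | (exfalso; dsimp at e0 e1 e2; linarith)

lemma modelTriangle_subset (hl : l ∈ Ioo (0 : ℝ) 1) (hd : d ∈ Ioo (0 : ℝ) 1) (j : Fin 5) :
    modelTriangle l d j ⊆ baseDiamond 2 d := by
  have hl0 := hl.1
  have hd0 := hd.1
  have hl2 := sub_pos.2 hl.2
  have hd2 := sub_pos.2 hd.2
  have hh : 0 ≤ innerHeight l d := by unfold innerHeight; positivity
  have hh2 : d * d + innerHeight l d ≤ d := by
    unfold innerHeight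
    nlinarith [mul_pos hl2 (mul_pos hd0 hd2)]
  refine convexHull_min ?_ (convex_convexHull ℝ _)
  rintro x (rfl | rfl | rfl) <;> refine (mem_baseDiamond_iff hd0).2 ?_ <;>
    fin_cases j <;> simp [modelVertex, abs_of_pos hd0, abs_of_nonneg hh, hh2]

/-- The model triangles and their reflections cover the model diamond. -/
lemma exists_mem_modelTriangle (hl : l ∈ Ioo (0 : ℝ) 1) (hd : d ∈ Ioo (0 : ℝ) 1) {x : Euc 2}
    (hx : x ∈ baseDiamond 2 d) : ∃ j, x ∈ modelTriangle l d j ∨ -x ∈ modelTriangle l d j := by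
  wlog h0 : 0 ≤ x 0 generalizing x
  · obtain ⟨j, hj⟩ := this (x := -x)
      (by rw [mem_baseDiamond_iff hd.1] at hx ⊢; simpa using hx) (by simp; linarith)
    exact ⟨j, by rwa [neg_neg, or_comm] at hj⟩
  have hl0 := hl.1
  have hd0 := hd.1
  have hl2 := sub_pos.2 hl.2
  have hd2 := sub_pos.2 hd.2
  have hh : 0 < innerHeight l d := by unfold innerHeight; positivity
  rw [mem_baseDiamond_iff hd0, abs_of_nonneg h0] at hx
  by_cases hs : d ≤ x 0 ∧ |x 1| ≤ l * d * (1 - x 0)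
  · exact ⟨1, Or.inl ((mem_modelTriangle_one hl hd).2 hs)⟩
  by_cases hr : x 0 ≤ d ∧ |x 1| ≤ innerHeight l d
  · refine ⟨0, ?_⟩
    rw [mem_modelTriangle_zero hl hd, mem_modelTriangle_zero hl hd]
    have := abs_le.1 hr.2
    simp only [PiLp.neg_apply]
    rcases le_total 0 (innerHeight l d * x 0 + d * x 1) with h | h
    · exact Or.inl ⟨hr.1, this.2, h⟩
    · exact Or.inr ⟨by linarith, by linarith, by linarith⟩
  by_cases hc : innerHeight l d ≤ |x 1| ∧ x 0 * (1 - l * (1 - d)) ≤ d - |x 1|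
  · refine ⟨2, ?_⟩
    rw [mem_modelTriangle_two hl hd, mem_modelTriangle_two hl hd]
    simp only [PiLp.neg_apply, abs_neg, abs_of_nonneg h0]
    rcases abs_cases (x 1) with ⟨h, -⟩ | ⟨h, -⟩ <;> rw [h] at hc
    · exact Or.inl hc
    · exact Or.inr hc
  have he : d - |x 1| ≤ x 0 * (1 - l * (1 - d)) ∧ l * d * (1 - x 0) ≤ |x 1| := by
    rcases le_total (x 0) d with h | h
    · have h1 : innerHeight l d ≤ |x 1| := by
        by_contra! h1
        exact hr ⟨h, h1.le⟩
      have h2 : d - |x 1| ≤ x 0 * (1 - l * (1 - d)) := by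
        by_contra! h2
        exact hc ⟨h1, h2.le⟩
      exact ⟨h2, by nlinarith [mul_nonneg hl2.le (sub_nonneg.2 h)]⟩
    · have h1 : l * d * (1 - x 0) ≤ |x 1| := by
        by_contra! h1
        exact hs ⟨h, h1.le⟩
      exact ⟨by nlinarith [mul_nonneg hl2.le (sub_nonneg.2 h)], h1⟩
  rcases abs_cases (x 1) with ⟨h, -⟩ | ⟨h, -⟩ <;> rw [h] at he hx
  · exact ⟨3, Or.inl ((mem_modelTriangle_three hl hd).2 ⟨by linarith, he⟩)⟩
  · exact ⟨4, Or.inl ((mem_modelTriangle_four hl hd).2 ⟨by linarith, by linarith, he.2⟩)⟩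

lemma modelDisp_eq_zero (hl : l ∈ Ioo (0 : ℝ) 1) (hd : d ∈ Ioo (0 : ℝ) 1) {x : Euc 2}
    (hx : d * |x 0| + |x 1| = d) : modelDisp l d x = 0 := by
  have hl0 := hl.1
  have hd0 := hd.1
  have hl2 := sub_pos.2 hl.2
  have hX : |x 0| ≤ 1 := by nlinarith [abs_nonneg (x 1)]
  have hY : |x 1| ≤ d := by nlinarith [abs_nonneg (x 0)]
  have e : d * (1 - |x 0|) - |x 1| = 0 := by linarith
  have h1 : 0 ≤ capSlope l d * (d - |x 1|) :=
    mul_nonneg (capSlope_pos hl hd).le (sub_nonneg.2 hY)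
  have h2 : 0 ≤ l * (1 - l) * d ^ 2 * (1 - |x 0|) :=
    mul_nonneg (by positivity) (sub_nonneg.2 hX)
  have hc (t : ℝ) : clamp 0 t = 0 := by simpa using abs_clamp_le 0 t
  apply euc_ext <;> simp [modelDisp, e, h1, h2, hc]

lemma capSlope_le (hl : l ∈ Ioo (0 : ℝ) 1) (hl' : l ≤ 1 / 2) (hd : d ∈ Ioo (0 : ℝ) 1) :
    capSlope l d ≤ 2 * (l * (1 - l)) := by
  have hw : 1 / 2 ≤ 1 - l * (1 - d) := by nlinarith [hl.1, hl.2, hd.1, hd.2]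
  have := mul_nonneg hl.1.le (sub_nonneg.2 hl.2.le)
  rw [capSlope, div_le_iff₀ (by linarith)]
  nlinarith [mul_nonneg this hd.1.le]

lemma norm_le_abs_add_abs (x : Euc 2) : ‖x‖ ≤ |x 0| + |x 1| := by
  rw [EuclideanSpace.norm_eq, Fin.sum_univ_two, Real.sqrt_le_left (by positivity)]
  simp only [Real.norm_eq_abs]
  nlinarith [abs_nonneg (x 0), abs_nonneg (x 1)]

lemma norm_modelDisp_le (hl : l ∈ Ioo (0 : ℝ) 1) (hl' : l ≤ 1 / 2) (hd : d ∈ Ioo (0 : ℝ) 1)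
    {x : Euc 2} (hx : x ∈ baseDiamond 2 d) : ‖modelDisp l d x‖ ≤ 3 * (l * (1 - l) * d) := by
  have hl0 := hl.1
  have hd0 := hd.1
  have hl2 := sub_pos.2 hl.2
  have hd2 := sub_pos.2 hd.2
  rw [mem_baseDiamond_iff hd0] at hx
  have hX0 := abs_nonneg (x 0)
  have hY0 := abs_nonneg (x 1)
  have hX : |x 0| ≤ 1 := by nlinarith
  have hY : |x 1| ≤ d := by nlinarith
  have hκ := capSlope_le hl hl' hd
  have hκ0 := (capSlope_pos hl hd).le
  have hll : 0 < l * (1 - l) := by positivity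
  have e : 0 ≤ d * (1 - |x 0|) - |x 1| := by linarith
  have h1 : |modelDisp l d x 0| ≤ 2 * (l * (1 - l) * d) := by
    refine (abs_clamp_le _ _).trans ?_
    rw [abs_of_nonneg (le_min (mul_nonneg hκ0 (sub_nonneg.2 hY)) (mul_nonneg hl0.le e))]
    refine (min_le_left _ _).trans ?_
    nlinarith [mul_nonneg hκ0 hY0]
  have h2 : |modelDisp l d x 1| ≤ l * (1 - l) * d := by
    refine ((abs_neg _).le.trans (abs_clamp_le _ _)).trans ?_
    rw [abs_of_nonneg (le_min (mul_nonneg (by positivity) (sub_nonneg.2 hX))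
      (mul_nonneg (by positivity) e))]
    refine (min_le_left _ _).trans ?_
    nlinarith [mul_nonneg (mul_nonneg hll.le (sq_nonneg d)) hX0,
      mul_nonneg (mul_nonneg hll.le hd0.le) hd2.le]
  linarith [norm_le_abs_add_abs (modelDisp l d x)]

lemma frobNorm_le {m : ℝ} (A : Mat 2)
    (h : |A 0 0| + |A 0 1| + |A 1 0| + |A 1 1| ≤ m) : frobNorm A ≤ m := by
  refine le_trans ?_ h
  rw [frobNorm, Real.sqrt_le_left (by positivity)]
  simp only [Fin.sum_univ_two]
  rw [← sq_abs (A 0 0), ← sq_abs (A 0 1), ← sq_abs (A 1 0), ← sq_abs (A 1 1)]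
  nlinarith [abs_nonneg (A 0 0), abs_nonneg (A 0 1), abs_nonneg (A 1 0), abs_nonneg (A 1 1),
    mul_nonneg (abs_nonneg (A 0 0)) (abs_nonneg (A 0 1)),
    mul_nonneg (add_nonneg (abs_nonneg (A 0 0)) (abs_nonneg (A 0 1))) (abs_nonneg (A 1 0)),
    mul_nonneg (add_nonneg (add_nonneg (abs_nonneg (A 0 0)) (abs_nonneg (A 0 1)))
      (abs_nonneg (A 1 0))) (abs_nonneg (A 1 1))]

/-- The model gradients on the inner rectangle and the side triangles are close to the first
phase, and strictly closer to it than to the second. -/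
lemma modelGrad_close_fst (hl : l ∈ Ioo (0 : ℝ) 1) (hd : d ∈ Ioo (0 : ℝ) (1 / 2)) {j : Fin 5}
    (hj : j ≤ 1) :
    frobNorm (modelGrad l d j - !![0, 1 - l; 0, 0]) ≤ 10 * (l * (1 - l) * d) ∧
      frobNorm (modelGrad l d j - !![0, 1 - l; 0, 0]) <
        frobNorm (modelGrad l d j - !![0, -l; 0, 0]) := by
  have hl0 := hl.1
  have hd0 := hd.1
  have hl2 := sub_pos.2 hl.2
  have hd2 : 0 < 1 - d := by linarith [hd.2]
  have hp : 0 < l * (1 - l) * d := by positivity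
  have hj' : j = 0 ∨ j = 1 := by omega
  constructor
  · apply frobNorm_le
    rcases hj' with rfl | rfl
    · simp [modelGrad, abs_of_pos hl0, abs_of_pos hd0, abs_of_pos hl2, abs_of_pos hd2]
      nlinarith
    · simp [modelGrad, abs_of_pos hl0, abs_of_pos hl2, abs_of_pos hd0]
      nlinarith
  · refine Real.sqrt_lt_sqrt (by positivity) ?_
    rcases hj' with rfl | rfl <;> simp [modelGrad, Fin.sum_univ_two]

/-- The remaining model gradients are close to the second phase, and strictly closer to it than
to the first. -/
lemma modelGrad_close_snd (hl : l ∈ Ioo (0 : ℝ) 1) (hl' : l ≤ 1 / 2)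
    (hd : d ∈ Ioo (0 : ℝ) (1 / 2)) {j : Fin 5} (hj : 2 ≤ j) :
    frobNorm (modelGrad l d j - !![0, -l; 0, 0]) ≤ 10 * (l * (1 - l) * d) ∧
      frobNorm (modelGrad l d j - !![0, -l; 0, 0]) <
        frobNorm (modelGrad l d j - !![0, 1 - l; 0, 0]) := by
  have hl0 := hl.1
  have hd0 := hd.1
  have hl2 := sub_pos.2 hl.2
  have hd2 : 0 < 1 - d := by linarith [hd.2]
  have hp : 0 < l * (1 - l) * d := by positivity
  have hld : l * d ≤ 2 * (l * (1 - l) * d) := by nlinarith [mul_pos hl0 hd0]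
  have hld2 : l * d ^ 2 ≤ l * d := by nlinarith [mul_pos hl0 hd0]
  have hw : 1 / 2 ≤ 1 - l * (1 - d) := by nlinarith
  have hw0 : 0 < 1 - l * (1 - d) := by linarith
  have hlk : l - capSlope l d = l * d / (1 - l * (1 - d)) := by
    rw [capSlope]; field_simp; ring
  have hlk0 : 0 ≤ l - capSlope l d := by rw [hlk]; positivity
  have hlk1 : l - capSlope l d ≤ 2 * (l * d) := by
    rw [hlk, div_le_iff₀ hw0]
    nlinarith [mul_pos hl0 hd0]
  have hlk2 : l - capSlope l d < 1 / 2 := by nlinarith [hd.2]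
  have hj' : j = 2 ∨ j = 3 ∨ j = 4 := by omega
  constructor
  · apply frobNorm_le
    rcases hj' with rfl | rfl | rfl
    · have : |-capSlope l d + l| = l - capSlope l d := by
        rw [abs_of_nonneg (by linarith)]; ring
      simp [modelGrad, this, abs_of_pos hl0, abs_of_pos hd0, abs_of_pos hl2, abs_of_pos hd2]
      nlinarith
    · simp [modelGrad, abs_of_pos hl0, abs_of_pos hd0]
      nlinarith
    · simp [modelGrad, abs_of_pos hl0, abs_of_pos hd0]
      nlinarith
  · refine Real.sqrt_lt_sqrt (by positivity) ?_
    rcases hj' with rfl | rfl | rfl <;> simp [modelGrad, Fin.sum_univ_two]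
    all_goals nlinarith

/-! ### Gradients of piecewise affine maps -/

lemma matVec_mul (A B : Mat 2) (x : Euc 2) : matVec (A * B) x = matVec A (matVec B x) := by
  apply euc_ext <;> simp [matVec_apply_zero, matVec_apply_one, Matrix.mul_apply] <;> ring

lemma matVec_one (x : Euc 2) : matVec (1 : Mat 2) x = x := by
  apply euc_ext <;> simp [matVec_apply_zero, matVec_apply_one]

lemma matVec_matrix_sub (A B : Mat 2) (x : Euc 2) :
    matVec (A - B) x = matVec A x - matVec B x := by
  apply euc_ext <;> simp [matVec_apply_zero, matVec_apply_one] <;> ring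

lemma matVec_matrix_neg (A : Mat 2) (x : Euc 2) : matVec (-A) x = -matVec A x := by
  apply euc_ext <;> simp [matVec_apply_zero, matVec_apply_one] <;> ring

lemma matVec_vec_neg (A : Mat 2) (x : Euc 2) : matVec A (-x) = -matVec A x :=
  map_neg (matCLM A) x

lemma volume_matVec_fiber_eq_zero {A : Mat 2} (hA : A ≠ 0) (c : Euc 2) :
    volume {x | matVec A x = c} = 0 :=
  volume_affine_fiber_eq_zero (Matrix.toEuclideanLin A) (by simpa using hA) c

/-- Almost everywhere gradients of a map that is affine on finitely many
closed convex sets with negligible overlaps. -/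
lemma exists_gradient {ι : Type*} [Finite ι] [Nonempty ι] {T : ι → Set (Euc 2)}
    {G : ι → Mat 2} {c : ι → Euc 2} {u : Euc 2 → Euc 2}
    (hconv : ∀ i, Convex ℝ (T i)) (hclosed : ∀ i, IsClosed (T i))
    (hnull : ∀ i j, i ≠ j → volume (T i ∩ T j) = 0)
    (hu : ∀ i, ∀ x ∈ T i, u x = matVec (G i) x + c i) :
    ∃ g : Euc 2 → Mat 2, (∀ x, ∃ i, g x = G i) ∧
      ∀ᵐ x, ∀ i, x ∈ T i → g x = G i ∧ HasFDerivAt u (matCLM (G i)) x := by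
  classical
  refine ⟨fun x => if h : ∃ i, x ∈ T i then G h.choose else G (Classical.arbitrary ι), ?_, ?_⟩
  · intro x
    by_cases h : ∃ i, x ∈ T i
    · exact ⟨_, dif_pos h⟩
    · exact ⟨_, dif_neg h⟩
  · have h1 : ∀ᵐ x, ∀ i j, i ≠ j → x ∉ T i ∩ T j := by
      simp only [ae_all_iff]
      exact fun i j hij => measure_eq_zero_iff_ae_notMem.1 (hnull i j hij)
    have h2 : ∀ᵐ x, ∀ i, x ∉ frontier (T i) := by
      simp only [ae_all_iff]
      exact fun i => measure_eq_zero_iff_ae_notMem.1 ((hconv i).addHaar_frontier volume)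
    filter_upwards [h1, h2] with x hx1 hx2 i hi
    have hex : ∃ i, x ∈ T i := ⟨i, hi⟩
    have hch : hex.choose = i := by
      by_contra hne
      exact hx1 _ _ hne ⟨hex.choose_spec, hi⟩
    refine ⟨by rw [dif_pos hex, hch], ?_⟩
    have hint : T i ∈ nhds x := by
      rw [← mem_interior_iff_mem_nhds]
      by_contra h
      exact hx2 i ((hclosed i).frontier_eq ▸ ⟨hi, h⟩)
    refine ((matCLM (G i)).hasFDerivAt.add_const (c i)).congr_of_eventuallyEq ?_
    filter_upwards [hint] with y hy
    exact hu i y hy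

lemma volume_gradient_mem {ι : Type*} [Fintype ι] {T : ι → Set (Euc 2)} {G : ι → Mat 2}
    {g : Euc 2 → Mat 2} (hclosed : ∀ i, IsClosed (T i))
    (hnull : ∀ i j, i ≠ j → volume (T i ∩ T j) = 0)
    (hg : ∀ᵐ x, ∀ i, x ∈ T i → g x = G i) (p : Mat 2 → Prop) [DecidablePred p] :
    volume {x ∈ ⋃ i, T i | p (g x)} = ∑ i, if p (G i) then volume (T i) else 0 := by
  have : ({x ∈ ⋃ i, T i | p (g x)} : Set (Euc 2)) =ᵐ[volume]
      ⋃ i ∈ Finset.univ.filter (fun i => p (G i)), T i := by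
    filter_upwards [hg] with x hx
    refine propext ?_
    change (x ∈ ⋃ i, T i) ∧ p (g x) ↔ x ∈ ⋃ i ∈ Finset.univ.filter (fun i => p (G i)), T i
    simp only [mem_iUnion, Finset.mem_filter, Finset.mem_univ, true_and, exists_prop]
    constructor
    · rintro ⟨⟨i, hi⟩, hp⟩
      exact ⟨i, hx i hi ▸ hp, hi⟩
    · rintro ⟨i, hp, hi⟩
      exact ⟨⟨i, hi⟩, (hx i hi).symm ▸ hp⟩
  rw [measure_congr this, measure_biUnion_finset₀ (fun i _ j _ hij => hnull i j hij)
    (fun i _ => (hclosed i).measurableSet.nullMeasurableSet), Finset.sum_filter]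

/-! ### Rotating the model -/

lemma frobNorm_eq_sqrt_trace (X : Mat 2) : frobNorm X = Real.sqrt (Xᵀ * X).trace := by
  simp only [frobNorm, Matrix.trace, Matrix.diag, Matrix.mul_apply, Matrix.transpose_apply,
    Fin.sum_univ_two]
  congr 1; ring

lemma frobNorm_conj {Q : Mat 2} (hQ : Qᵀ * Q = 1) (X : Mat 2) :
    frobNorm (Q * X * Qᵀ) = frobNorm X := by
  have : (Q * X * Qᵀ)ᵀ * (Q * X * Qᵀ) = Q * (Xᵀ * X * Qᵀ) := by
    simp only [Matrix.transpose_mul, Matrix.transpose_transpose, Matrix.mul_assoc]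
    rw [← Matrix.mul_assoc Qᵀ Q, hQ, Matrix.one_mul]
  rw [frobNorm_eq_sqrt_trace, frobNorm_eq_sqrt_trace, this, Matrix.trace_mul_comm,
    Matrix.mul_assoc, hQ, Matrix.mul_one]

lemma frobNorm_smul (c : ℝ) (X : Mat 2) : frobNorm (c • X) = |c| * frobNorm X := by
  rw [frobNorm, frobNorm, ← Real.sqrt_sq_eq_abs, ← Real.sqrt_mul (sq_nonneg c)]
  simp only [Matrix.smul_apply, smul_eq_mul, Fin.sum_univ_two]
  congr 1; ring

/-- The volumes of the model triangles, relative to the standard simplex. -/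
def modelWeight (l d : ℝ) : Fin 5 → ℝ :=
  ![4 * d * innerHeight l d, 2 * innerHeight l d * (1 - d), 2 * d * (d - innerHeight l d),
    d * (1 - d) * (1 - l), d * (1 - d) * (1 - l)]

lemma modelWeight_nonneg (hl : l ∈ Ioo (0 : ℝ) 1) (hd : d ∈ Ioo (0 : ℝ) 1) (j : Fin 5) :
    0 ≤ modelWeight l d j := by
  have hl0 := hl.1
  have hd0 := hd.1
  have hl2 := sub_pos.2 hl.2
  have hd2 := sub_pos.2 hd.2
  have hh : 0 ≤ innerHeight l d := by unfold innerHeight; positivity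
  have hh2 : 0 ≤ d - innerHeight l d := by
    unfold innerHeight
    nlinarith [mul_pos hl2 (mul_pos hd0 hd2)]
  fin_cases j <;> dsimp [modelWeight] <;> positivity

lemma volume_modelTriangle (hl : l ∈ Ioo (0 : ℝ) 1) (hd : d ∈ Ioo (0 : ℝ) 1) (j : Fin 5) :
    volume (modelTriangle l d j) = ENNReal.ofReal (modelWeight l d j) * volume stdTriangle := by
  have hw := modelWeight_nonneg hl hd j
  rw [modelTriangle, volume_triangle]
  congr 2
  rw [abs_eq hw]
  fin_cases j
  · right; simp [modelVertex, modelWeight]; ring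
  · left; simp [modelVertex, modelWeight]; ring
  · right; simp [modelVertex, modelWeight]; ring
  · left; simp [modelVertex, modelWeight, innerHeight]; ring
  · right; simp [modelVertex, modelWeight, innerHeight]; ring

/-- The rotated model triangles and their reflections. -/
def rotTriangle (Q : Mat 2) (l d : ℝ) (i : Fin 5 × Bool) : Set (Euc 2) :=
  matVec (cond i.2 Q (-Q)) '' modelTriangle l d i.1

lemma rotTriangle_eq (Q : Mat 2) (l d : ℝ) (i : Fin 5 × Bool) :
    ∃ p q r : Euc 2, rotTriangle Q l d i = convexHull ℝ {p, q, r} := by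
  let S : Mat 2 := cond i.2 Q (-Q)
  refine ⟨matVec S (modelVertex l d i.1 0), matVec S (modelVertex l d i.1 1),
    matVec S (modelVertex l d i.1 2), ((Matrix.toEuclideanLin S).image_convexHull _).trans ?_⟩
  rw [image_insert_eq, image_insert_eq, image_singleton]
  rfl

lemma isClosed_rotTriangle (Q : Mat 2) (l d : ℝ) (i : Fin 5 × Bool) :
    IsClosed (rotTriangle Q l d i) := by
  obtain ⟨p, q, r, h⟩ := rotTriangle_eq Q l d i
  rw [h]
  exact (Set.toFinite _).isClosed_convexHull ℝ

lemma convex_rotTriangle (Q : Mat 2) (l d : ℝ) (i : Fin 5 × Bool) :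
    Convex ℝ (rotTriangle Q l d i) := by
  obtain ⟨p, q, r, h⟩ := rotTriangle_eq Q l d i
  rw [h]
  exact convex_convexHull ℝ _

lemma mem_image_matVec_iff {Q : Mat 2} (hQ : Qᵀ * Q = 1) {S : Set (Euc 2)} {x : Euc 2} :
    x ∈ matVec Q '' S ↔ matVec Qᵀ x ∈ S := by
  constructor
  · rintro ⟨y, hy, rfl⟩
    rwa [← matVec_mul, hQ, matVec_one]
  · intro h
    exact ⟨_, h, by rw [← matVec_mul, mul_eq_one_comm.1 hQ, matVec_one]⟩

lemma mem_rotTriangle_iff {Q : Mat 2} (hQ : Qᵀ * Q = 1) {i : Fin 5 × Bool} {x : Euc 2} :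
    x ∈ rotTriangle Q l d i ↔ cond i.2 (matVec Qᵀ x) (-matVec Qᵀ x) ∈ modelTriangle l d i.1 := by
  obtain ⟨j, _ | _⟩ := i
  · rw [rotTriangle, mem_image_matVec_iff (by simpa using hQ)]
    simp [matVec_matrix_neg]
  · rw [rotTriangle, mem_image_matVec_iff (by simpa using hQ)]
    simp

lemma volume_rotTriangle (hl : l ∈ Ioo (0 : ℝ) 1) (hd : d ∈ Ioo (0 : ℝ) 1) {Q : Mat 2}
    (hdet : Q.det = 1) (i : Fin 5 × Bool) : volume (rotTriangle Q l d i) =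
      ENNReal.ofReal (modelWeight l d i.1) * volume stdTriangle := by
  have : |(cond i.2 Q (-Q)).det| = 1 := by
    cases i.2 <;> simp [Matrix.det_neg, hdet]
  rw [rotTriangle, volume_matVec_image, this, ENNReal.ofReal_one, one_mul,
    volume_modelTriangle hl hd]

lemma iUnion_rotTriangle (hl : l ∈ Ioo (0 : ℝ) 1) (hd : d ∈ Ioo (0 : ℝ) 1) {Q : Mat 2}
    (hQ : Qᵀ * Q = 1) : ⋃ i, rotTriangle Q l d i = matVec Q '' baseDiamond 2 d := by
  ext x
  rw [mem_image_matVec_iff hQ, mem_iUnion]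
  constructor
  · rintro ⟨⟨j, _ | _⟩, hi⟩
    · have := modelTriangle_subset hl hd j ((mem_rotTriangle_iff hQ).1 hi)
      rw [mem_baseDiamond_iff hd.1] at this ⊢
      simpa using this
    · exact modelTriangle_subset hl hd j ((mem_rotTriangle_iff hQ).1 hi)
  · intro hx
    obtain ⟨j, hj | hj⟩ := exists_mem_modelTriangle hl hd hx
    · exact ⟨(j, true), (mem_rotTriangle_iff hQ).2 hj⟩
    · exact ⟨(j, false), (mem_rotTriangle_iff hQ).2 hj⟩

/-- The rotated and rescaled model displacement superposed on a linear map. -/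
def rotMap (M Q : Mat 2) (α l d : ℝ) (x : Euc 2) : Euc 2 :=
  matVec M x + α • matVec Q (modelDisp l d (matVec Qᵀ x))

/-- The gradients of `rotMap`. -/
def rotGrad (M Q : Mat 2) (α l d : ℝ) (j : Fin 5) : Mat 2 :=
  M + α • (Q * modelGrad l d j * Qᵀ)

lemma continuous_rotMap (M Q : Mat 2) (α l d : ℝ) : Continuous (rotMap M Q α l d) :=
  (matCLM M).continuous.add (((matCLM Q).continuous.comp
    ((continuous_modelDisp l d).comp (matCLM Qᵀ).continuous)).const_smul α)

lemma rotMap_eq (hl : l ∈ Ioo (0 : ℝ) 1) (hd : d ∈ Ioo (0 : ℝ) 1) (M : Mat 2) {Q : Mat 2}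
    (hQ : Qᵀ * Q = 1) (α : ℝ) {i : Fin 5 × Bool} {x : Euc 2} (hx : x ∈ rotTriangle Q l d i) :
    rotMap M Q α l d x = matVec (rotGrad M Q α l d i.1) x +
      α • cond i.2 (matVec Q (modelShift l d i.1)) (-matVec Q (modelShift l d i.1)) := by
  rw [mem_rotTriangle_iff hQ] at hx
  have h := modelDisp_eq hl hd hx
  have hg : matVec (rotGrad M Q α l d i.1) x =
      matVec M x + α • matVec Q (matVec (modelGrad l d i.1) (matVec Qᵀ x)) := by
    rw [← matVec_mul, ← matVec_mul]
    apply euc_ext <;> simp [rotGrad, matVec_apply_zero, matVec_apply_one] <;> ring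
  have hadd (y z : Euc 2) : matVec Q (y + z) = matVec Q y + matVec Q z := map_add (matCLM Q) y z
  obtain ⟨j, _ | _⟩ := i
  · simp only [cond_false, modelDisp_neg, matVec_vec_neg] at h ⊢ hg
    rw [hg, rotMap, ← neg_neg (modelDisp l d (matVec Qᵀ x)), h, matVec_vec_neg, hadd,
      matVec_vec_neg]
    module
  · simp only [cond_true] at h ⊢ hg
    rw [hg, rotMap, h, hadd]
    module

lemma rotGrad_injective (hl : l ∈ Ioo (0 : ℝ) 1) (hd : d ∈ Ioo (0 : ℝ) 1) (M : Mat 2) {Q : Mat 2}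
    (hQ : Qᵀ * Q = 1) {α : ℝ} (hα : α ≠ 0) : Function.Injective (rotGrad M Q α l d) := by
  intro i j hij
  have h1 : Q * modelGrad l d i * Qᵀ = Q * modelGrad l d j * Qᵀ :=
    smul_right_injective _ hα (add_left_cancel hij)
  have h2 (X : Mat 2) : Qᵀ * (Q * X * Qᵀ) * Q = X := by
    simp only [Matrix.mul_assoc, hQ, Matrix.mul_one]
    rw [← Matrix.mul_assoc, hQ, Matrix.one_mul]
  apply modelGrad_injective hl hd
  rw [← h2 (modelGrad l d i), h1, h2]

lemma volume_rotTriangle_inter (hl : l ∈ Ioo (0 : ℝ) 1) (hd : d ∈ Ioo (0 : ℝ) 1) {Q : Mat 2}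
    (hQ : Qᵀ * Q = 1) {i i' : Fin 5 × Bool} (hi : i ≠ i') :
    volume (rotTriangle Q l d i ∩ rotTriangle Q l d i') = 0 := by
  by_cases hj : i.1 = i'.1
  · obtain ⟨j, b⟩ := i
    obtain ⟨j', b'⟩ := i'
    obtain rfl : j = j' := hj
    have hN : modelNormal l d j * Qᵀ ≠ 0 := by
      intro h
      apply modelNormal_ne_zero hd.1.ne' j
      rw [← Matrix.mul_one (modelNormal l d j), ← hQ, ← Matrix.mul_assoc, h, Matrix.zero_mul]
    refine measure_mono_null ?_ (volume_matVec_fiber_eq_zero hN 0)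
    rintro x ⟨hx, hx'⟩
    have h1 := modelNormal_nonneg hl hd ((mem_rotTriangle_iff hQ).1 hx)
    have h2 := modelNormal_nonneg hl hd ((mem_rotTriangle_iff hQ).1 hx')
    have h3 : matVec (modelNormal l d j) (matVec Qᵀ x) 0 = 0 := by
      have hb : b ≠ b' := by rintro rfl; exact hi rfl
      cases b <;> cases b' <;> simp_all [matVec_vec_neg] <;> linarith
    rw [mem_ofPred_eq, matVec_mul]
    refine euc_ext h3 ?_
    rw [matVec_apply_one]
    fin_cases j <;> simp [modelNormal]
  · have hne : rotGrad 0 Q 1 l d i.1 - rotGrad 0 Q 1 l d i'.1 ≠ 0 :=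
      sub_ne_zero.2 fun h => hj (rotGrad_injective hl hd 0 hQ one_ne_zero h)
    refine measure_mono_null ?_ (volume_matVec_fiber_eq_zero hne
      ((1 : ℝ) • cond i'.2 (matVec Q (modelShift l d i'.1)) (-matVec Q (modelShift l d i'.1)) -
        (1 : ℝ) • cond i.2 (matVec Q (modelShift l d i.1)) (-matVec Q (modelShift l d i.1))))
    rintro x ⟨hx, hx'⟩
    rw [mem_ofPred_eq, matVec_matrix_sub, sub_eq_sub_iff_add_eq_add, add_comm _ (matVec _ x),
      ← rotMap_eq hl hd 0 hQ 1 hx, add_comm, add_comm, ← rotMap_eq hl hd 0 hQ 1 hx']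

lemma frobNorm_rotGrad_sub {A M Q : Mat 2} {α : ℝ} (hQ : Qᵀ * Q = 1) {X : Mat 2}
    (hA : A = M + α • (Q * X * Qᵀ)) (j : Fin 5) :
    frobNorm (rotGrad M Q α l d j - A) = |α| * frobNorm (modelGrad l d j - X) := by
  rw [hA, rotGrad, add_sub_add_left_eq_sub, ← smul_sub, ← Matrix.sub_mul, ← Matrix.mul_sub,
    frobNorm_smul, frobNorm_conj hQ]

lemma trace_rotGrad (M : Mat 2) {Q : Mat 2} (hQ : Qᵀ * Q = 1) (α : ℝ) (j : Fin 5) :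
    (rotGrad M Q α l d j).trace = M.trace := by
  have : (modelGrad l d j).trace = 0 := by
    fin_cases j <;> simp [modelGrad, Matrix.trace_fin_two]
  rw [rotGrad, Matrix.trace_add, Matrix.trace_smul, Matrix.trace_mul_comm, ← Matrix.mul_assoc,
    hQ, Matrix.one_mul, this, smul_zero, add_zero]

lemma norm_matVec {Q : Mat 2} (hQ : Qᵀ * Q = 1) (x : Euc 2) : ‖matVec Q x‖ = ‖x‖ := by
  have h00 := congrFun (congrFun hQ 0) 0
  have h01 := congrFun (congrFun hQ 0) 1
  have h11 := congrFun (congrFun hQ 1) 1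
  simp [Matrix.mul_apply, Fin.sum_univ_two] at h00 h01 h11
  rw [EuclideanSpace.norm_eq, EuclideanSpace.norm_eq]
  congr 1
  simp only [Fin.sum_univ_two, Real.norm_eq_abs, sq_abs, matVec_apply_zero, matVec_apply_one]
  linear_combination x 0 ^ 2 * h00 + 2 * x 0 * x 1 * h01 + x 1 ^ 2 * h11

/-- The existence of the construction at scale `s`, symmetric in the two phases. -/
def HasContiConstruction (A B M : Mat 2) (l d s : ℝ) : Prop :=
  ∃ (Ω : Set (Euc 2)) (u : Euc 2 → Euc 2) (g : Euc 2 → Mat 2),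
    IsDiamond 2 d Ω ∧ IsPiecewiseAffine Ω u ∧
    (∀ x ∈ frontier Ω, u x = matVec M x) ∧
    (∀ᵐ x, x ∈ Ω → HasFDerivAt u (matCLM (g x)) x) ∧
    (∀ x, (g x).trace = 0) ∧
    (∀ x, min (frobNorm (g x - A)) (frobNorm (g x - B)) ≤ 10 * (l * (1 - l) * d) * s) ∧
    (∀ x, frobNorm (g x - A) ≠ frobNorm (g x - B)) ∧
    (∃ v ∈ Ioo (1 / 2 : ℝ) 2, volume {x ∈ Ω | frobNorm (g x - A) < frobNorm (g x - B)} =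
      ENNReal.ofReal (v * l) * volume Ω) ∧
    (∃ v ∈ Ioo (1 / 2 : ℝ) 2, volume {x ∈ Ω | frobNorm (g x - B) < frobNorm (g x - A)} =
      ENNReal.ofReal (v * (1 - l)) * volume Ω) ∧
    (∃ V : Finset (Mat 2), V.card ≤ 5 ∧ ∀ x, g x ∈ V) ∧
    (∃ T : Fin 10 → Set (Euc 2), (∀ i, ∃ p q r : Euc 2, T i = convexHull ℝ {p, q, r}) ∧
      AEPartition Ω T ∧
      ∀ i, ∃ (f : Euc 2 →ₗ[ℝ] Euc 2) (b : Euc 2), ∀ x ∈ T i, u x = f x + b) ∧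
    ∀ x ∈ Ω, ‖u x - matVec M x‖ ≤ 10 * (l * (1 - l) * d) * s

lemma HasContiConstruction.swap {A B M : Mat 2} {l d s : ℝ}
    (h : HasContiConstruction A B M l d s) : HasContiConstruction B A M (1 - l) d s := by
  obtain ⟨Ω, u, g, h1, h2, h3, h4, h5, h6, h7, h8, h9, h10, h11, h12⟩ := h
  have e : (1 - l) * (1 - (1 - l)) * d = l * (1 - l) * d := by ring
  refine ⟨Ω, u, g, h1, h2, h3, h4, h5, ?_, fun x => (h7 x).symm, h9, ?_, h10, h11, ?_⟩
  · rw [e]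
    exact fun x => min_comm (frobNorm (g x - A)) _ ▸ h6 x
  · simpa only [_root_.sub_sub_cancel] using h8
  · rwa [e]

lemma hasContiConstruction_of_rotation (hl : l ∈ Ioo (0 : ℝ) 1) (hl' : l ≤ 1 / 2)
    (hd : d ∈ Ioo (0 : ℝ) (1 / 2)) {A B M Q : Mat 2} {α : ℝ} (hα : α ≠ 0) (hQ : Qᵀ * Q = 1)
    (hdet : Q.det = 1) (hM : M.trace = 0) (hA : A = M + α • (Q * !![0, 1 - l; 0, 0] * Qᵀ))
    (hB : B = M + α • (Q * !![0, -l; 0, 0] * Qᵀ)) : HasContiConstruction A B M l d |α| := by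
  classical
  have hd1 : d ∈ Ioo (0 : ℝ) 1 := ⟨hd.1, by linarith [hd.2]⟩
  have hl0 := hl.1
  have hd0 := hd.1
  have hl2 := sub_pos.2 hl.2
  have hα0 : 0 < |α| := abs_pos.2 hα
  have hp : 0 < l * (1 - l) * d := by positivity
  have hnull : ∀ i j, i ≠ j → volume (rotTriangle Q l d i ∩ rotTriangle Q l d j) = 0 :=
    fun i j hij => volume_rotTriangle_inter hl hd1 hQ hij
  have hU := iUnion_rotTriangle hl hd1 hQ
  obtain ⟨g, hg, hgd⟩ := exists_gradient (convex_rotTriangle Q l d) (isClosed_rotTriangle Q l d)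
    hnull (fun i x hx => rotMap_eq hl hd1 M hQ α hx)
  have hg' : ∀ x, ∃ j, g x = rotGrad M Q α l d j := fun x => let ⟨i, hi⟩ := hg x; ⟨i.1, hi⟩
  have hfst {j : Fin 5} (hj : j ≤ 1) :
      frobNorm (rotGrad M Q α l d j - A) ≤ 10 * (l * (1 - l) * d) * |α| ∧
        frobNorm (rotGrad M Q α l d j - A) < frobNorm (rotGrad M Q α l d j - B) := by
    rw [frobNorm_rotGrad_sub hQ hA, frobNorm_rotGrad_sub hQ hB, mul_comm _ |α|]
    obtain ⟨h1, h2⟩ := modelGrad_close_fst hl hd hj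
    exact ⟨by gcongr, by gcongr⟩
  have hsnd {j : Fin 5} (hj : 2 ≤ j) :
      frobNorm (rotGrad M Q α l d j - B) ≤ 10 * (l * (1 - l) * d) * |α| ∧
        frobNorm (rotGrad M Q α l d j - B) < frobNorm (rotGrad M Q α l d j - A) := by
    rw [frobNorm_rotGrad_sub hQ hA, frobNorm_rotGrad_sub hQ hB, mul_comm _ |α|]
    obtain ⟨h1, h2⟩ := modelGrad_close_snd hl hl' hd hj
    exact ⟨by gcongr, by gcongr⟩
  have hcases (j : Fin 5) : j ≤ 1 ∨ 2 ≤ j := by omega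
  have hltA (j : Fin 5) : frobNorm (rotGrad M Q α l d j - A) <
      frobNorm (rotGrad M Q α l d j - B) ↔ j ≤ 1 := by
    refine ⟨fun h => ?_, fun h => (hfst h).2⟩
    exact (hcases j).resolve_right fun hj => lt_asymm h (hsnd hj).2
  have hltB (j : Fin 5) : frobNorm (rotGrad M Q α l d j - B) <
      frobNorm (rotGrad M Q α l d j - A) ↔ 2 ≤ j := by
    refine ⟨fun h => ?_, fun h => (hsnd h).2⟩
    exact (hcases j).resolve_left fun hj => lt_asymm h (hfst hj).2
  have hvol (p : Mat 2 → Prop) [DecidablePred p] :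
      volume {x ∈ matVec Q '' baseDiamond 2 d | p (g x)} =
        ENNReal.ofReal (2 * ∑ j, if p (rotGrad M Q α l d j) then modelWeight l d j else 0) *
          volume stdTriangle := by
    rw [← hU, volume_gradient_mem (isClosed_rotTriangle Q l d) hnull
      (hgd.mono fun x hx i hi => (hx i hi).1), Fintype.sum_prod_type]
    simp only [Fintype.sum_bool, volume_rotTriangle hl hd1 hdet, ← two_mul]
    rw [← Finset.mul_sum, ENNReal.ofReal_mul zero_le_two, ENNReal.ofReal_sum_of_nonneg, mul_assoc,
      Finset.sum_mul]
    · congr 1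
      · simp
      · refine Finset.sum_congr rfl fun j _ => ?_
        split_ifs <;> simp
    · intro j _
      split_ifs
      · exact modelWeight_nonneg hl hd1 j
      · exact le_rfl
  have hvolΩ : volume (matVec Q '' baseDiamond 2 d) =
      ENNReal.ofReal (4 * d) * volume stdTriangle := by
    have := hvol (fun _ => True)
    simp only [and_true, ofPred_mem_eq, if_true] at this
    rw [this]
    congr 2
    simp [Fin.sum_univ_five, modelWeight, innerHeight]
    ring
  have hfrac {v : ℝ} (hv : 0 ≤ v) (p : Mat 2 → Prop) [DecidablePred p]
      (h : 2 * ∑ j, (if p (rotGrad M Q α l d j) then modelWeight l d j else 0) = v * (4 * d)) :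
      volume {x ∈ matVec Q '' baseDiamond 2 d | p (g x)} =
        ENNReal.ofReal v * volume (matVec Q '' baseDiamond 2 d) := by
    rw [hvol p, hvolΩ, h, ENNReal.ofReal_mul hv, mul_assoc]
  have haff (i : Fin 5 × Bool) : ∃ (f : Euc 2 →ₗ[ℝ] Euc 2) (b : Euc 2),
      ∀ x ∈ rotTriangle Q l d i, rotMap M Q α l d x = f x + b :=
    ⟨Matrix.toEuclideanLin (rotGrad M Q α l d i.1), _, fun x hx => rotMap_eq hl hd1 M hQ α hx⟩
  let e : Fin 10 ≃ Fin 5 × Bool := (Fintype.equivFinOfCardEq (by simp)).symm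
  have hUe : ⋃ k, rotTriangle Q l d (e k) = matVec Q '' baseDiamond 2 d := by
    rw [← hU]
    exact e.surjective.iUnion_comp (rotTriangle Q l d)
  refine ⟨matVec Q '' baseDiamond 2 d, rotMap M Q α l d, g, ?_, ?_, ?_, ?_, ?_, ?_, ?_, ?_, ?_, ?_,
    ?_, ?_⟩
  · exact ⟨0, 1, Q, one_pos, hQ, hdet, by simp⟩
  · refine ⟨(continuous_rotMap M Q α l d).continuousOn, 10, fun k => rotTriangle Q l d (e k),
      fun k => ?_, hUe.ge, fun k => ?_⟩
    · obtain ⟨p, q, r, h⟩ := rotTriangle_eq Q l d (e k)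
      exact ⟨{p, q, r}, by simpa using h⟩
    · obtain ⟨f, b, h⟩ := haff (e k)
      exact ⟨f, b, fun x hx => h x hx.1⟩
  · intro x hx
    have hset : matVec Q '' baseDiamond 2 d =
        {x | d * |matVec Qᵀ x 0| + |matVec Qᵀ x 1| ≤ d} := by
      ext y
      rw [mem_image_matVec_iff hQ, mem_baseDiamond_iff hd0]
      rfl
    have hc : Continuous fun x => d * |matVec Qᵀ x 0| + |matVec Qᵀ x 1| := by
      simp only [matVec]
      fun_prop
    rw [hset] at hx
    have := modelDisp_eq_zero hl hd1 (frontier_le_subset_eq hc continuous_const hx)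
    have h0 : matVec Q 0 = 0 := map_zero (matCLM Q)
    rw [rotMap, this, h0, smul_zero, add_zero]
  · filter_upwards [hgd] with x hx hxΩ
    rw [← hU, mem_iUnion] at hxΩ
    obtain ⟨i, hi⟩ := hxΩ
    rw [(hx i hi).1]
    exact (hx i hi).2
  · intro x
    obtain ⟨j, hj⟩ := hg' x
    rw [hj, trace_rotGrad M hQ, hM]
  · intro x
    obtain ⟨j, hj⟩ := hg' x
    rw [hj]
    rcases hcases j with h | h
    · exact (min_le_left _ _).trans (hfst h).1
    · exact (min_le_right _ _).trans (hsnd h).1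
  · intro x
    obtain ⟨j, hj⟩ := hg' x
    rw [hj]
    rcases hcases j with h | h
    · exact (hfst h).2.ne
    · exact (hsnd h).2.ne'
  · have hd4 : d ^ 2 < 1 / 4 := by nlinarith [hd.2]
    refine ⟨1 - d ^ 2, ⟨by linarith, by nlinarith⟩, hfrac (mul_nonneg (by linarith) hl0.le)
      (fun X => frobNorm (X - A) < frobNorm (X - B)) ?_⟩
    simp only [hltA]
    simp [Fin.sum_univ_five, modelWeight, innerHeight]
    ring
  · have hd4 : d ^ 2 < 1 / 4 := by nlinarith [hd.2]
    have hll : l / (1 - l) ≤ 1 := (div_le_one hl2).2 (by linarith)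
    have hll0 : 0 ≤ l / (1 - l) := by positivity
    refine ⟨1 + l / (1 - l) * d ^ 2, ⟨by nlinarith, by nlinarith⟩,
      hfrac (mul_nonneg (by positivity) hl2.le)
      (fun X => frobNorm (X - B) < frobNorm (X - A)) ?_⟩
    simp only [hltB]
    simp [Fin.sum_univ_five, modelWeight, innerHeight]
    field_simp
    ring
  · refine ⟨Finset.univ.image (rotGrad M Q α l d), Finset.card_image_le.trans (by simp), ?_⟩
    intro x
    obtain ⟨j, hj⟩ := hg' x
    exact hj ▸ Finset.mem_image_of_mem _ (Finset.mem_univ j)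
  · refine ⟨fun k => rotTriangle Q l d (e k), fun k => rotTriangle_eq Q l d (e k),
      ⟨?_, ?_, fun i j hij => hnull _ _ (e.injective.ne hij)⟩, fun k => haff (e k)⟩
    · rw [hUe, sdiff_self, measure_empty]
    · rw [hUe, sdiff_self, measure_empty]
  · intro x hx
    have := norm_modelDisp_le hl hl' hd1 ((mem_image_matVec_iff hQ).1 hx)
    rw [rotMap, add_sub_cancel_left, norm_smul, norm_matVec hQ, Real.norm_eq_abs]
    nlinarith

lemma hasContiConstruction {A B M : Mat 2} {a nv : Euc 2} {l d : ℝ} (ha : a ≠ 0) (hn : ‖nv‖ = 1)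
    (hA : A.trace = 0) (hB : B.trace = 0)
    (hAB : A - B = Matrix.vecMulVec (fun i => a i) (fun j => nv j)) (hl : l ∈ Ioo (0 : ℝ) 1)
    (hM : M = l • A + (1 - l) • B) (hd : d ∈ Ioo (0 : ℝ) (1 / 2)) :
    HasContiConstruction A B M l d ‖a‖ := by
  wlog hl' : l ≤ 1 / 2 generalizing A B a l
  · have := this (A := B) (B := A) (a := -a) (l := 1 - l) (neg_ne_zero.2 ha) hB hA
      (by
        rw [← neg_sub, hAB]
        ext i j
        simp [Matrix.vecMulVec_apply])
      ⟨by linarith [hl.2], by linarith [hl.1]⟩ (by rw [hM, _root_.sub_sub_cancel, add_comm])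
      (by linarith)
    rw [norm_neg] at this
    simpa using this.swap
  have hn2 : nv 0 ^ 2 + nv 1 ^ 2 = 1 := by
    have := EuclideanSpace.norm_sq_eq nv
    rw [hn] at this
    simpa [Fin.sum_univ_two] using this.symm
  have hij (i j : Fin 2) : A i j - B i j = a i * nv j := congrFun (congrFun hAB i) j
  have hort : a 0 * nv 0 + a 1 * nv 1 = 0 := by
    rw [Matrix.trace_fin_two] at hA hB
    linear_combination hA - hB - hij 0 0 - hij 1 1
  set α := a 0 * nv 1 - a 1 * nv 0 with hαdef
  have ha0 : a 0 = α * nv 1 := by linear_combination nv 0 * hort - a 0 * hn2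
  have ha1 : a 1 = -(α * nv 0) := by linear_combination nv 1 * hort - a 1 * hn2
  have hnorm : ‖a‖ = |α| := by
    rw [EuclideanSpace.norm_eq, ← Real.sqrt_sq_eq_abs]
    congr 1
    simp only [Fin.sum_univ_two, Real.norm_eq_abs, sq_abs]
    rw [ha0, ha1]
    linear_combination α ^ 2 * hn2
  have hα : α ≠ 0 := by rwa [← abs_pos, ← hnorm, norm_pos_iff]
  have hconj (t : ℝ) : (!![nv 1, nv 0; -nv 0, nv 1] : Mat 2) * !![0, t; 0, 0] *
      (!![nv 1, nv 0; -nv 0, nv 1] : Mat 2)ᵀ =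
        !![t * nv 1 * nv 0, t * nv 1 * nv 1; -(t * nv 0 * nv 0), -(t * nv 0 * nv 1)] := by
    ext i j
    fin_cases i <;> fin_cases j <;> simp [Matrix.mul_apply, Fin.sum_univ_two, mul_comm t]
  rw [hnorm]
  refine hasContiConstruction_of_rotation hl hl' hd (Q := !![nv 1, nv 0; -nv 0, nv 1]) hα
    ?_ ?_ ?_ ?_ ?_
  · ext i j
    fin_cases i <;> fin_cases j <;> simp [Matrix.mul_apply, Fin.sum_univ_two] <;> linarith
  · rw [Matrix.det_fin_two_of]
    linarith
  · rw [hM]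
    simp [Matrix.trace_add, hA, hB]
  · rw [hconj, hM]
    have h00 := hij 0 0
    have h01 := hij 0 1
    have h10 := hij 1 0
    have h11 := hij 1 1
    rw [ha0] at h00 h01
    rw [ha1] at h10 h11
    ext i j
    fin_cases i <;> fin_cases j <;> simp
    · linear_combination (1 - l) * h00
    · linear_combination (1 - l) * h01
    · linear_combination (1 - l) * h10
    · linear_combination (1 - l) * h11
  · rw [hconj, hM]
    have h00 := hij 0 0
    have h01 := hij 0 1
    have h10 := hij 1 0
    have h11 := hij 1 1
    rw [ha0] at h00 h01
    rw [ha1] at h10 h11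
    ext i j
    fin_cases i <;> fin_cases j <;> simp
    · linear_combination -l * h00
    · linear_combination -l * h01
    · linear_combination -l * h10
    · linear_combination -l * h11

end Model

/-- The divergence-free (linearised) Conti construction in 2D: for trace-free
rank-one connected `A, B` and `M = λA + (1−λ)B` there is a universal constant
`C > 0` such that for every `δ ∈ (0,1/2)` there are a diamond `Ω_δ` of aspect ratio
`1:δ` and a piecewise affine map `u` with affine boundary data `Mx`, vanishing
divergence, gradient `Cλ(1−λ)δ|a|`-close to `{A,B}` with the stated volume
fractions, at most five gradient values, subordinate to a partition into 10
triangles, and `‖u − Mx‖_{L^∞} ≤ Cδλ(1−λ)|a|`. -/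
theorem conti_construction_2D :
    ∃ C : ℝ, 0 < C ∧
      ∀ (A B : Mat 2) (a nv : Euc 2), a ≠ 0 → ‖nv‖ = 1 →
        Matrix.trace A = 0 → Matrix.trace B = 0 →
        A - B = Matrix.vecMulVec (fun i => a i) (fun j => nv j) →
        ∀ lam : ℝ, lam ∈ Set.Ioo (0 : ℝ) 1 →
        ∀ M : Mat 2, M = lam • A + (1 - lam) • B →
        ∀ δ : ℝ, δ ∈ Set.Ioo (0 : ℝ) (1/2) →
          ∃ (Ωδ : Set (Euc 2)) (u : Euc 2 → Euc 2) (g : Euc 2 → Mat 2),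
            IsDiamond 2 δ Ωδ ∧ IsPiecewiseAffine Ωδ u ∧
            (∀ x ∈ frontier Ωδ, u x = matVec M x) ∧
            (∀ᵐ x, x ∈ Ωδ → HasFDerivAt u (matCLM (g x)) x) ∧
            (∀ᵐ x, x ∈ Ωδ → Matrix.trace (g x) = 0) ∧
            (∀ᵐ x, x ∈ Ωδ →
              min (frobNorm (g x - A)) (frobNorm (g x - B))
                ≤ C * lam * (1 - lam) * δ * ‖a‖) ∧
            (∃ vA ∈ Set.Ioo (1/2 : ℝ) 2, ∃ vB ∈ Set.Ioo (1/2 : ℝ) 2,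
              volume {x ∈ Ωδ | frobNorm (g x - A) < frobNorm (g x - B)}
                = ENNReal.ofReal (vA * lam) * volume Ωδ ∧
              volume {x ∈ Ωδ | frobNorm (g x - B) ≤ frobNorm (g x - A)}
                = ENNReal.ofReal (vB * (1 - lam)) * volume Ωδ) ∧
            (∃ V : Finset (Mat 2), V.card ≤ 5 ∧ ∀ᵐ x, x ∈ Ωδ → g x ∈ V) ∧
            (∃ T : Fin 10 → Set (Euc 2),
              (∀ i, ∃ p q r : Euc 2, T i = convexHull ℝ {p, q, r}) ∧
              AEPartition Ωδ T ∧
              ∀ i, ∃ (f : Euc 2 →ₗ[ℝ] Euc 2) (b : Euc 2), ∀ x ∈ T i, u x = f x + b) ∧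
            (∀ x ∈ Ωδ, ‖u x - matVec M x‖ ≤ C * δ * lam * (1 - lam) * ‖a‖) := by
  refine ⟨10, by norm_num, ?_⟩
  intro A B a nv ha hn hA hB hAB l hl M hM d hd
  obtain ⟨Ω, u, g, h1, h2, h3, h4, h5, h6, h7, ⟨v, hv, hvA⟩, ⟨w, hw, hwB⟩, ⟨V, hV, hgV⟩, h11,
      h12⟩ :=
    hasContiConstruction ha hn hA hB hAB hl hM hd
  have h7' : {x ∈ Ω | frobNorm (g x - B) ≤ frobNorm (g x - A)} =
      {x ∈ Ω | frobNorm (g x - B) < frobNorm (g x - A)} := by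
    ext x
    exact and_congr_right fun _ => ⟨fun h => h.lt_of_ne (h7 x).symm, le_of_lt⟩
  refine ⟨Ω, u, g, h1, h2, h3, h4, ae_of_all _ fun x _ => h5 x,
    ae_of_all _ fun x _ => (h6 x).trans_eq (by ring), ⟨v, hv, w, hw, hvA, ?_⟩,
    ⟨V, hV, ae_of_all _ fun x _ => hgV x⟩, h11, fun x hx => (h12 x hx).trans_eq (by ring)⟩
  rw [h7', hwB]
end
end

section
/- Let n, N, k ∈ ℕ, R > 0, and let v₁,…,v_N ∈ ℝ^{n×n} satisfy |v_j| ≤ 2R for all j. Let λ₁,…,λ_k ∈ [0,1] and S₁,…,S_k ∈ {v₁,…,v_N}. Then there exist signs ε₁,…,ε_k ∈ {−1,+1} such that for every k₀ ∈ {1,…,k} the partial sum Σ_{i=1}^{k₀} λ_i ε_i S_i belongs to the set {Σ_{j=1}^{N} μ_j v_j : μ_j ∈ [−1,1] for all j}; in particular |Σ_{i=1}^{k₀} λ_i ε_i S_i| ≤ 2NR for every k₀ ∈ {1,…,k}. -/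
noncomputable section
open MeasureTheory Set ENNReal Matrix

section FrobeniusNorm

attribute [local instance] Matrix.frobeniusNormedAddCommGroup Matrix.frobeniusNormedSpace

lemma frobNorm_eq_norm {n : ℕ} (A : Mat n) : frobNorm A = ‖A‖ := by
  rw [frobNorm, Matrix.frobenius_norm_def, Real.sqrt_eq_rpow]
  simp

/-- The Frobenius norm of a combination with coefficients in `[-1, 1]` of vectors bounded by `C`. -/
lemma frobNorm_sum_smul_le {n N : ℕ} {C : ℝ} {v : Fin N → Mat n} (hv : ∀ j, frobNorm (v j) ≤ C)
    {μ : Fin N → ℝ} (hμ : ∀ j, μ j ∈ Set.Icc (-1 : ℝ) 1) :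
    frobNorm (∑ j, μ j • v j) ≤ N * C := by
  simp only [frobNorm_eq_norm] at hv ⊢
  calc ‖∑ j, μ j • v j‖ ≤ ∑ _j : Fin N, C := by
        refine norm_sum_le_of_le _ fun j _ => ?_
        rw [norm_smul, Real.norm_eq_abs]
        exact (mul_le_of_le_one_left (norm_nonneg _) (abs_le.2 (hμ j))).trans (hv j)
    _ = N * C := by simp

end FrobeniusNorm

/-- The sign pushing `x` towards zero. -/
def opposingSign (x : ℝ) : ℝ := if x ≤ 0 then 1 else -1

lemma opposingSign_eq_or (x : ℝ) : opposingSign x = 1 ∨ opposingSign x = -1 := by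
  unfold opposingSign
  split_ifs <;> simp

lemma add_mul_opposingSign_mem_Icc {x t : ℝ} (hx : x ∈ Set.Icc (-1 : ℝ) 1)
    (ht : t ∈ Set.Icc (0 : ℝ) 1) : x + t * opposingSign x ∈ Set.Icc (-1 : ℝ) 1 := by
  obtain ⟨hx₁, hx₂⟩ := hx
  obtain ⟨ht₁, ht₂⟩ := ht
  unfold opposingSign
  split_ifs <;> constructor <;> linarith

/-- The coefficients obtained after `m` steps by greedily choosing the opposing sign. -/
def greedyCoeff {N k : ℕ} (lam : Fin k → ℝ) (J : Fin k → Fin N) : ℕ → Fin N → ℝ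
  | 0 => 0
  | m + 1 =>
    if h : m < k then
      greedyCoeff lam J m +
        Pi.single (J ⟨m, h⟩) (lam ⟨m, h⟩ * opposingSign (greedyCoeff lam J m (J ⟨m, h⟩)))
    else greedyCoeff lam J m

lemma greedyCoeff_mem_Icc {N k : ℕ} {lam : Fin k → ℝ} (hlam : ∀ i, lam i ∈ Set.Icc (0 : ℝ) 1)
    (J : Fin k → Fin N) (m : ℕ) (j : Fin N) : greedyCoeff lam J m j ∈ Set.Icc (-1 : ℝ) 1 := by
  induction m with
  | zero => simp [greedyCoeff]
  | succ m ih =>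
    rw [greedyCoeff]
    split_ifs with h
    · by_cases hj : j = J ⟨m, h⟩
      · subst hj
        simpa using add_mul_opposingSign_mem_Icc ih (hlam ⟨m, h⟩)
      · simpa [Pi.single_eq_of_ne hj] using ih
    · exact ih

lemma sum_greedyCoeff_smul {E : Type*} [AddCommGroup E] [Module ℝ E] {N k : ℕ}
    (lam : Fin k → ℝ) (J : Fin k → Fin N) (v : Fin N → E) {m : ℕ} (hm : m ≤ k) :
    ∑ i ∈ Finset.univ.filter (fun i : Fin k => (i : ℕ) < m),
      (lam i * opposingSign (greedyCoeff lam J i (J i))) • v (J i) =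
        ∑ j, greedyCoeff lam J m j • v j := by
  induction m with
  | zero => simp [greedyCoeff]
  | succ m ih =>
    have h : m < k := hm
    have hfilter : Finset.univ.filter (fun i : Fin k => (i : ℕ) < m + 1) =
        insert ⟨m, h⟩ (Finset.univ.filter (fun i : Fin k => (i : ℕ) < m)) := by
      ext i
      simp only [Finset.mem_filter, Finset.mem_univ, true_and, Finset.mem_insert, Fin.ext_iff]
      omega
    rw [hfilter, Finset.sum_insert (by simp), ih h.le, greedyCoeff, dif_pos h]
    simp [add_smul, Finset.sum_add_distrib, Pi.single_apply, ite_smul, add_comm]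

/-- Skew control (choice of signs): for jumps `S_i` taken among `v_1, …, v_N` with
`|v_j| ≤ 2R` and coefficients `λ_i ∈ [0,1]` there are signs `ε_i ∈ {±1}` such that
every partial sum `Σ_{i≤k₀} λ_i ε_i S_i` lies in
`{Σ_j μ_j v_j : μ_j ∈ [−1,1]}`; in particular its Frobenius norm is at most `2NR`. -/
theorem skew_sign_choice (n N k : ℕ) (R : ℝ) (hR : 0 < R)
    (v : Fin N → Mat n) (hv : ∀ j, frobNorm (v j) ≤ 2 * R)
    (lam : Fin k → ℝ) (hlam : ∀ i, lam i ∈ Set.Icc (0 : ℝ) 1)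
    (S : Fin k → Mat n) (hS : ∀ i, ∃ j, S i = v j) :
    ∃ ε : Fin k → ℝ, (∀ i, ε i = 1 ∨ ε i = -1) ∧
      ∀ k₀ : ℕ, 1 ≤ k₀ → k₀ ≤ k →
        (∃ μ : Fin N → ℝ, (∀ j, μ j ∈ Set.Icc (-1 : ℝ) 1) ∧
          (∑ i ∈ Finset.univ.filter (fun i : Fin k => (i : ℕ) < k₀),
            (lam i * ε i) • S i) = ∑ j, μ j • v j) ∧
        frobNorm (∑ i ∈ Finset.univ.filter (fun i : Fin k => (i : ℕ) < k₀),
            (lam i * ε i) • S i) ≤ 2 * N * R := by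
  choose J hJ using hS
  refine ⟨fun i => opposingSign (greedyCoeff lam J i (J i)),
    fun i => opposingSign_eq_or _, fun k₀ _ hk₀ => ?_⟩
  have hμ := greedyCoeff_mem_Icc hlam J k₀
  simp only [hJ]
  rw [sum_greedyCoeff_smul lam J v hk₀]
  exact ⟨⟨_, hμ, rfl⟩, (frobNorm_sum_smul_le hv hμ).trans_eq (by ring)⟩
end
end
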